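/- arXiv:1309.4624 — 2 statements merged into one kernel-verified Lean document; each statement's English description precedes it below -/
import Mathlib

section
/- Let p = 1, let (β_j)_{j≥1} be nonnegative reals with Σ_{j≥1} β_j < (4 · max(2/(2 sin(π/b))², 1/(2 sin(π/b))) · (3 + 2/b + (2b+1)/(b−1)) · (2 + 1/b))^{−1}, let b be a prime, and set α := 2. Then there exists a constant C < ∞, depending only on (β_j) and b, with the following property: for every integer s ≥ 1 and every integer m ≥ 1 with N := b^m, there exist points y₀, …, y_{N−1} ∈ [0,1]^s such that for every constant c > 0 and every function F : [0,1]^s → ℝ possessing continuous partial derivatives of order up to 2 in each variable and satisfying |(∂_y^ν F)(y)| ≤ c · |ν|! · ∏_{j=1}^s β_j^{ν_j} for all y ∈ [0,1]^s and all multi-indices ν ∈ {0,1,2}^s, the quadrature error satisfies | (1/N)·Σ_{n=0}^{N−1} F(y_n) − ∫_{[0,1]^s} F(y) dy | ≤ c · C · N^{−1}. -/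
open MeasureTheory Real

theorem volume_unitAddCircle_eq : (volume : Measure UnitAddCircle) = AddCircle.haarAddCircle := by
  rw [AddCircle.volume_eq_smul_haarAddCircle]; simp

theorem measurePreserving_two_mul_norm :
    MeasurePreserving (fun x : UnitAddCircle => 2 * ‖x‖) AddCircle.haarAddCircle
      (volume.restrict (Set.Icc (0 : ℝ) 1)) := by
  have hm : Measurable fun x : UnitAddCircle => 2 * ‖x‖ := by fun_prop
  refine ⟨hm, ?_⟩
  have : IsFiniteMeasure (Measure.map (fun x : UnitAddCircle => 2 * ‖x‖)
    (AddCircle.haarAddCircle : Measure UnitAddCircle)) := Measure.isFiniteMeasure_map _ _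
  refine Measure.ext_of_Iic _ _ fun a => ?_
  rw [Measure.map_apply hm measurableSet_Iic, Measure.restrict_apply measurableSet_Iic]
  have h1 : (fun x : UnitAddCircle => 2 * ‖x‖) ⁻¹' Set.Iic a = Metric.closedBall 0 (a / 2) := by
    ext x
    simp only [Set.mem_preimage, Set.mem_Iic, Metric.mem_closedBall, dist_zero_right]
    constructor <;> intro h <;> linarith
  have h2 : Set.Iic a ∩ Set.Icc (0 : ℝ) 1 = Set.Icc 0 (min 1 a) := by
    ext x
    simp only [Set.mem_inter_iff, Set.mem_Iic, Set.mem_Icc, le_min_iff]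
    tauto
  rw [h1, h2, ← volume_unitAddCircle_eq, AddCircle.volume_closedBall, Real.volume_Icc]
  congr 2
  ring_nf

theorem integral_fourier_neg_mul_comp_two_mul_norm (n : ℤ) {f : ℝ → ℝ} (hf : Continuous f) :
    ∫ x : UnitAddCircle, fourier (-n) x * (f (2 * ‖x‖) : ℂ) ∂AddCircle.haarAddCircle =
      ((∫ y in (0 : ℝ)..1, cos (π * n * y) * f y : ℝ) : ℂ) := by
  rw [← volume_unitAddCircle_eq, ← UnitAddCircle.intervalIntegral_preimage (-(1 / 2))]
  have hsum : (-(1 / 2) : ℝ) + 1 = 1 / 2 := by norm_num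
  rw [hsum]
  set g : ℝ → ℂ := fun x => Complex.exp (-(2 * π * n * x) * Complex.I) * (f (2 * |x|) : ℂ) with hg
  have hgc : Continuous g := by fun_prop
  have hgn : Continuous fun x => g (-x) := by fun_prop
  have h1 : ∫ x in (-(1 / 2) : ℝ)..1 / 2,
      fourier (-n) (x : UnitAddCircle) * (f (2 * ‖(x : UnitAddCircle)‖) : ℂ) =
      ∫ x in (-(1 / 2) : ℝ)..1 / 2, g x := by
    refine intervalIntegral.integral_congr fun x hx => ?_
    rw [Set.uIcc_of_le (by norm_num)] at hx
    have hx' : |x| ≤ |(1 : ℝ)| / 2 := by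
      rw [abs_one, abs_le]; constructor <;> linarith [hx.1, hx.2]
    simp only [hg]
    rw [(AddCircle.norm_coe_eq_abs_iff (p := (1 : ℝ)) one_ne_zero).2 hx', fourier_coe_apply]
    congr 2
    push_cast
    ring
  have h2 : ∫ x in (-(1 / 2) : ℝ)..0, g x = ∫ x in (0 : ℝ)..1 / 2, g (-x) := by
    rw [intervalIntegral.integral_comp_neg]; simp
  rw [h1, ← intervalIntegral.integral_add_adjacent_intervals
    (hgc.intervalIntegrable _ 0) (hgc.intervalIntegrable 0 _), h2,
    ← intervalIntegral.integral_add (hgn.intervalIntegrable _ _)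
      (hgc.intervalIntegrable _ _)]
  have h3 : ∫ x in (0 : ℝ)..1 / 2, g (-x) + g x =
      ∫ x in (0 : ℝ)..1 / 2, ((2 * (cos (π * n * (2 * x)) * f (2 * x)) : ℝ) : ℂ) := by
    refine intervalIntegral.integral_congr fun x hx => ?_
    rw [Set.uIcc_of_le (by norm_num)] at hx
    simp only [hg, abs_neg, abs_of_nonneg hx.1]
    rw [← add_mul]
    push_cast
    rw [← mul_assoc, Complex.two_cos]
    congr 1
    rw [add_comm, add_comm (Complex.exp _)]
    congr 2 <;> ring
  rw [h3, intervalIntegral.integral_ofReal, intervalIntegral.integral_const_mul,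
    intervalIntegral.integral_comp_mul_left (fun y => cos (π * n * y) * f y) two_ne_zero]
  norm_num
  ring

theorem integral_fourier_neg_mul_comp_two_mul_norm_eq_of_hasDerivAt {n : ℤ} (hn : n ≠ 0)
    {f f' f'' : ℝ → ℝ} (hf : ∀ y, HasDerivAt f (f' y) y) (hf' : ∀ y, HasDerivAt f' (f'' y) y)
    (hf'' : Continuous f'') :
    ∫ x : UnitAddCircle, fourier (-n) x * (f (2 * ‖x‖) : ℂ) ∂AddCircle.haarAddCircle =
      ((1 / (π * n) ^ 2 : ℝ) : ℂ) * (((cos (π * n) * f' 1 - f' 0 : ℝ) : ℂ) -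
        ∫ x : UnitAddCircle, fourier (-n) x * (f'' (2 * ‖x‖) : ℂ) ∂AddCircle.haarAddCircle) := by
  have hfc : Continuous f := continuous_iff_continuousAt.2 fun y => (hf y).continuousAt
  rw [integral_fourier_neg_mul_comp_two_mul_norm n hfc,
    integral_fourier_neg_mul_comp_two_mul_norm n hf'']
  norm_cast
  have hne : π * (n : ℝ) ≠ 0 := mul_ne_zero pi_ne_zero (by exact_mod_cast hn)
  have hd : ∀ y : ℝ, HasDerivAt
      (fun y => sin (π * n * y) / (π * n) * f y + cos (π * n * y) / (π * n) ^ 2 * f' y)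
      (cos (π * n * y) * f y + 1 / (π * n) ^ 2 * (cos (π * n * y) * f'' y)) y := by
    intro y
    have hlin : HasDerivAt (fun y : ℝ => π * n * y) (π * n) y := by
      simpa using (hasDerivAt_id y).const_mul (π * (n : ℝ))
    have := ((hlin.sin.div_const (π * n)).mul (hf y)).add
      ((hlin.cos.div_const ((π * n) ^ 2)).mul (hf' y))
    refine this.congr_deriv ?_
    field_simp
    ring
  have := intervalIntegral.integral_eq_sub_of_hasDerivAt (a := 0) (b := 1) (fun y _ => hd y)
    (Continuous.intervalIntegrable (by fun_prop) _ _)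
  rw [intervalIntegral.integral_add (Continuous.intervalIntegrable (by fun_prop) _ _)
    (Continuous.intervalIntegrable (by fun_prop) _ _), intervalIntegral.integral_const_mul] at this
  have hs : sin (π * n) = 0 := by rw [mul_comm]; exact sin_int_mul_pi n
  simp only [mul_one, mul_zero, sin_zero, cos_zero, zero_div, zero_mul, hs, zero_add] at this
  linear_combination this

/-- The map `x ↦ (2‖x₁‖, …, 2‖xₛ‖)` folding the torus onto the unit cube. -/
noncomputable def foldTorus {s : ℕ} (x : UnitAddTorus (Fin s)) : Fin s → ℝ := fun j => 2 * ‖x j‖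

/-- The normalized Haar measure on the torus. -/
noncomputable def torusHaar (s : ℕ) : Measure (UnitAddTorus (Fin s)) :=
  Measure.pi fun _ => AddCircle.haarAddCircle

instance (s : ℕ) : IsProbabilityMeasure (torusHaar s) := by
  unfold torusHaar; infer_instance

@[fun_prop]
theorem continuous_foldTorus {s : ℕ} : Continuous (foldTorus (s := s)) := by
  unfold foldTorus; fun_prop

theorem two_mul_norm_mem_Icc (x : UnitAddCircle) : 2 * ‖x‖ ∈ Set.Icc (0 : ℝ) 1 := by
  have := AddCircle.norm_le_half_period (p := (1 : ℝ)) one_ne_zero (x := x)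
  rw [abs_one] at this
  exact ⟨by positivity, by linarith⟩

theorem foldTorus_cons {s : ℕ} (a : UnitAddCircle) (x : UnitAddTorus (Fin s)) :
    foldTorus (s := s + 1) (Fin.cons a x) = Fin.cons (2 * ‖a‖) (foldTorus x) := by
  ext j
  refine Fin.cases ?_ (fun j => ?_) j <;> simp [foldTorus]

theorem mFourier_cons {s : ℕ} (n : Fin (s + 1) → ℤ) (a : UnitAddCircle)
    (x : UnitAddTorus (Fin s)) :
    UnitAddTorus.mFourier n (Fin.cons a x : UnitAddTorus (Fin (s + 1))) =
      fourier (n 0) a * UnitAddTorus.mFourier (Fin.tail n) x := by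
  simp [UnitAddTorus.mFourier, Fin.prod_univ_succ, Fin.tail]

theorem integral_torusHaar_succ {s : ℕ} (f : UnitAddTorus (Fin (s + 1)) → ℂ) :
    ∫ x, f x ∂torusHaar (s + 1) =
      ∫ p : UnitAddCircle × UnitAddTorus (Fin s), f (Fin.cons p.1 p.2)
        ∂(AddCircle.haarAddCircle.prod (torusHaar s)) := by
  have h := (measurePreserving_piFinSuccAbove
    (fun _ : Fin (s + 1) => (AddCircle.haarAddCircle : Measure UnitAddCircle)) 0).symm
  have := h.integral_comp' f
  simp only [MeasurableEquiv.piFinSuccAbove_symm_apply, Fin.insertNthEquiv_zero] at this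
  exact this.symm

theorem integrable_prod_of_continuous {s : ℕ} {g : UnitAddCircle × UnitAddTorus (Fin s) → ℂ}
    (hg : Continuous g) : Integrable g (AddCircle.haarAddCircle.prod (torusHaar s)) :=
  hg.integrable_of_hasCompactSupport (.of_compactSpace _)

theorem foldTorus_mem {s : ℕ} (x : UnitAddTorus (Fin s)) (i : Fin s) :
    foldTorus x i ∈ Set.Icc (0 : ℝ) 1 := two_mul_norm_mem_Icc _

/-- The Fourier coefficient of the folded function. -/
noncomputable def foldCoeff {s : ℕ} (Φ : (Fin s → ℝ) → ℝ) (n : Fin s → ℤ) : ℂ :=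
  ∫ x, UnitAddTorus.mFourier (-n) x * (Φ (foldTorus x) : ℂ) ∂torusHaar s

theorem continuous_cons_left {s : ℕ} {Φ : (Fin (s + 1) → ℝ) → ℝ} (hΦ : Continuous Φ) :
    Continuous fun p : UnitAddCircle × UnitAddTorus (Fin s) =>
      Φ (Fin.cons (2 * ‖p.1‖) (foldTorus p.2)) := by
  refine hΦ.comp (continuous_pi fun j => ?_)
  refine Fin.cases ?_ (fun j => ?_) j
  · simp only [Fin.cons_zero]; fun_prop
  · simp only [Fin.cons_succ, foldTorus]; fun_prop

theorem foldCoeff_succ {s : ℕ} {Φ : (Fin (s + 1) → ℝ) → ℝ} (hΦ : Continuous Φ)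
    (n : Fin (s + 1) → ℤ) :
    foldCoeff Φ n = ∫ a : UnitAddCircle, fourier (-(n 0)) a *
      foldCoeff (fun y => Φ (Fin.cons (2 * ‖a‖) y)) (Fin.tail n) ∂AddCircle.haarAddCircle := by
  have hc := continuous_cons_left hΦ
  rw [foldCoeff, integral_torusHaar_succ]
  simp only [mFourier_cons, foldTorus_cons]
  rw [integral_prod _ (integrable_prod_of_continuous (by fun_prop))]
  refine integral_congr_ae (.of_forall fun a => ?_)
  simp only [foldCoeff]
  rw [← integral_const_mul]
  refine integral_congr_ae (.of_forall fun x => ?_)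
  simp only [mul_assoc]
  rfl

theorem foldCoeff_succ_swap {s : ℕ} {Φ : (Fin (s + 1) → ℝ) → ℝ} (hΦ : Continuous Φ)
    (n : Fin (s + 1) → ℤ) :
    foldCoeff Φ n = ∫ x, UnitAddTorus.mFourier (-Fin.tail n) x *
      ∫ a : UnitAddCircle, fourier (-(n 0)) a * (Φ (Fin.cons (2 * ‖a‖) (foldTorus x)) : ℂ)
        ∂AddCircle.haarAddCircle ∂torusHaar s := by
  have hc := continuous_cons_left hΦ
  rw [foldCoeff, integral_torusHaar_succ]
  simp only [mFourier_cons, foldTorus_cons]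
  rw [integral_prod_symm _ (integrable_prod_of_continuous (by fun_prop))]
  refine integral_congr_ae (.of_forall fun x => ?_)
  simp only
  rw [← integral_const_mul]
  refine integral_congr_ae (.of_forall fun a => ?_)
  simp only [Pi.neg_apply]
  have : Fin.tail (-n) = -Fin.tail n := rfl
  rw [this]
  ring

/-- `Fd ν` is the mixed partial derivative of order `ν` of `Fd 0`, for `ν ∈ {0, 1, 2}ˢ`. -/
structure IsMixedDerivFamily {s : ℕ} (Fd : (Fin s → ℕ) → (Fin s → ℝ) → ℝ) : Prop where
  continuous : ∀ ν : Fin s → ℕ, (∀ i, ν i ≤ 2) → Continuous (Fd ν)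
  hasLineDerivAt : ∀ (ν : Fin s → ℕ) (j : Fin s), (∀ i, ν i ≤ 2) → ν j < 2 →
    ∀ x : Fin s → ℝ, HasLineDerivAt ℝ (Fd ν) (Fd (ν + Pi.single j 1) x) x (Pi.single j 1)

namespace IsMixedDerivFamily

theorem slice {s : ℕ} {Fd : (Fin (s + 1) → ℕ) → (Fin (s + 1) → ℝ) → ℝ}
    (h : IsMixedDerivFamily Fd) {a : ℕ} (ha : a ≤ 2) (t : ℝ) :
    IsMixedDerivFamily fun (ν : Fin s → ℕ) y => Fd (Fin.cons a ν) (Fin.cons t y) := by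
  have hle : ∀ ν : Fin s → ℕ, (∀ i, ν i ≤ 2) →
      ∀ i, (Fin.cons a ν : Fin (s + 1) → ℕ) i ≤ 2 :=
    fun ν hν i => Fin.cases (by simpa using ha) (fun i => by simpa using hν i) i
  refine ⟨fun ν hν => (h.continuous _ (hle ν hν)).comp (by fun_prop), fun ν j hν hj x => ?_⟩
  have := h.hasLineDerivAt (Fin.cons a ν) j.succ (hle ν hν) (by simpa using hj) (Fin.cons t x)
  have e : ∀ {R : Type} [AddCommMonoid R] (r b : R) (f : Fin s → R),
      (Fin.cons b f : Fin (s + 1) → R) + Pi.single j.succ r = Fin.cons b (f + Pi.single j r) := by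
    intro R _ r b f
    ext i
    refine Fin.cases ?_ (fun i => ?_) i
    · simp
    · simp [Pi.single_apply]
  rw [e] at this
  unfold HasLineDerivAt at this ⊢
  refine this.congr_of_eventuallyEq (.of_forall fun u => ?_)
  simp only [← Pi.single_smul, e]

theorem hasDerivAt {s : ℕ} {Fd : (Fin (s + 1) → ℕ) → (Fin (s + 1) → ℝ) → ℝ}
    (h : IsMixedDerivFamily Fd) {a : ℕ} (ha : a < 2) (x : Fin s → ℝ) (t : ℝ) :
    HasDerivAt (fun t => Fd (Fin.cons a 0) (Fin.cons t x)) (Fd (Fin.cons (a + 1) 0) (Fin.cons t x))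
      t := by
  have h1 := h.hasLineDerivAt (Fin.cons a 0) 0
    (fun i => Fin.cases (by simpa using ha.le) (fun i => by simp) i) (by simpa using ha)
    (Fin.cons t x)
  have e : ∀ {R : Type} [AddCommMonoid R] (r b : R) (f : Fin s → R),
      (Fin.cons b f : Fin (s + 1) → R) + Pi.single 0 r = Fin.cons (b + r) f := by
    intro R _ r b f
    ext i
    refine Fin.cases ?_ (fun i => ?_) i <;> simp
  rw [e] at h1
  unfold HasLineDerivAt at h1
  simp only [← Pi.single_smul, e, smul_eq_mul, mul_one] at h1
  have h2 : HasDerivAt (fun u : ℝ => u - t) 1 t := by simpa using (hasDerivAt_id t).sub_const t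
  have h3 := HasDerivAt.comp t (h₂ := fun u => Fd (Fin.cons a 0) (Fin.cons (t + u) x))
    (h := fun u => u - t) (by simpa using h1) h2
  simpa [Function.comp_def] using h3

end IsMixedDerivFamily

theorem integrable_torus_of_continuous {s : ℕ} {g : UnitAddTorus (Fin s) → ℂ}
    (hg : Continuous g) : Integrable g (torusHaar s) :=
  hg.integrable_of_hasCompactSupport (.of_compactSpace _)

theorem IsMixedDerivFamily.foldCoeff_eq {s : ℕ}
    {Fd : (Fin (s + 1) → ℕ) → (Fin (s + 1) → ℝ) → ℝ} (h : IsMixedDerivFamily Fd)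
    {n : Fin (s + 1) → ℤ} (hn : n 0 ≠ 0) :
    foldCoeff (Fd 0) n = ((1 / (π * n 0) ^ 2 : ℝ) : ℂ) *
      ((cos (π * n 0) : ℝ) * foldCoeff (fun y => Fd (Fin.cons 1 0) (Fin.cons 1 y)) (Fin.tail n) -
        foldCoeff (fun y => Fd (Fin.cons 1 0) (Fin.cons 0 y)) (Fin.tail n) -
        foldCoeff (Fd (Fin.cons 2 0)) n) := by
  have hle : ∀ a : ℕ, a ≤ 2 → ∀ i, (Fin.cons a 0 : Fin (s + 1) → ℕ) i ≤ 2 :=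
    fun a ha i => Fin.cases (by simpa using ha) (fun i => by simp) i
  have hc0 : Continuous (Fd 0) := h.continuous 0 (by simp)
  have hc1 : Continuous (Fd (Fin.cons 1 0)) := h.continuous _ (hle 1 (by norm_num))
  have hc2 : Continuous (Fd (Fin.cons 2 0)) := h.continuous _ (hle 2 le_rfl)
  have h0 : (Fin.cons 0 0 : Fin (s + 1) → ℕ) = 0 := Fin.cons_self_tail 0
  have hparts : ∀ x : UnitAddTorus (Fin s), _ := fun x =>
    integral_fourier_neg_mul_comp_two_mul_norm_eq_of_hasDerivAt hn
      (h.hasDerivAt (a := 0) (by norm_num) (foldTorus x))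
      (h.hasDerivAt (a := 1) (by norm_num) (foldTorus x))
      (hc2.comp (by fun_prop : Continuous fun t : ℝ =>
        (Fin.cons t (foldTorus x) : Fin (s + 1) → ℝ)))
  rw [foldCoeff_succ_swap hc0, foldCoeff_succ_swap hc2]
  simp only [h0, zero_add, one_add_one_eq_two] at hparts
  simp only [hparts, foldCoeff]
  have i1 : ∀ t : ℝ, Integrable (fun x => UnitAddTorus.mFourier (-Fin.tail n) x *
      (Fd (Fin.cons 1 0) (Fin.cons t (foldTorus x)) : ℂ)) (torusHaar s) := fun t =>
    integrable_torus_of_continuous <| by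
      have : Continuous fun x : UnitAddTorus (Fin s) =>
        Fd (Fin.cons 1 0) (Fin.cons t (foldTorus x)) := hc1.comp (by fun_prop)
      fun_prop
  have i2 : Integrable (fun x => UnitAddTorus.mFourier (-Fin.tail n) x *
      ∫ a : UnitAddCircle, fourier (-(n 0)) a *
        (Fd (Fin.cons 2 0) (Fin.cons (2 * ‖a‖) (foldTorus x)) : ℂ)
        ∂AddCircle.haarAddCircle) (torusHaar s) := by
    simp only [← integral_const_mul]
    have := continuous_cons_left hc2
    exact (integrable_prod_of_continuous
      (g := fun p => UnitAddTorus.mFourier (-Fin.tail n) p.2 * (fourier (-(n 0)) p.1 *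
        (Fd (Fin.cons 2 0) (Fin.cons (2 * ‖p.1‖) (foldTorus p.2)) : ℂ)))
      (by fun_prop)).integral_prod_right
  have i3 : Integrable (fun x => ((cos (π * n 0) : ℝ) : ℂ) *
      (UnitAddTorus.mFourier (-Fin.tail n) x *
        (Fd (Fin.cons 1 0) (Fin.cons 1 (foldTorus x)) : ℂ)) -
      UnitAddTorus.mFourier (-Fin.tail n) x *
        (Fd (Fin.cons 1 0) (Fin.cons 0 (foldTorus x)) : ℂ)) (torusHaar s) :=
    ((i1 1).const_mul _).sub (i1 0)
  rw [← integral_const_mul, ← integral_sub ((i1 1).const_mul _) (i1 0), ← integral_sub i3 i2,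
    ← integral_const_mul]
  refine integral_congr_ae (.of_forall fun x => ?_)
  push_cast
  ring

/-- The decay in the frequency `n` contributed by a coordinate that is differentiated `i` times. -/
noncomputable def decayWeight (n : ℤ) (i : Fin 3) : ℝ :=
  if n = 0 then (if i = 0 then 1 else 0) else if i = 0 then 0 else 1 / (n : ℝ) ^ 2

theorem decayWeight_nonneg (n : ℤ) (i : Fin 3) : 0 ≤ decayWeight n i := by
  unfold decayWeight; split_ifs <;> positivity

theorem norm_mFourier_apply {s : ℕ} (n : Fin s → ℤ) (x : UnitAddTorus (Fin s)) :
    ‖UnitAddTorus.mFourier n x‖ ≤ 1 :=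
  ((UnitAddTorus.mFourier n).norm_coe_le_norm x).trans_eq UnitAddTorus.mFourier_norm

theorem norm_integral_fourier_mul_le {g : UnitAddCircle → ℂ} {n : ℤ} {K : ℝ}
    (hg : ∀ a, ‖g a‖ ≤ K) : ‖∫ a, fourier n a * g a ∂AddCircle.haarAddCircle‖ ≤ K := by
  refine (norm_integral_le_of_norm_le_const (C := K) (.of_forall fun a => ?_)).trans_eq (by simp)
  rw [norm_mul, fourier_apply, Circle.norm_coe, one_mul]
  exact hg a

theorem sum_prod_cons {s : ℕ} (w : Fin (s + 1) → Fin 3 → ℝ) (B : (Fin (s + 1) → ℕ) → ℝ) :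
    ∑ ν : Fin (s + 1) → Fin 3, (∏ j, w j (ν j)) * B (fun j => (ν j : ℕ)) =
      ∑ i : Fin 3, w 0 i * ∑ ν : Fin s → Fin 3, (∏ j, w j.succ (ν j)) *
        B (Fin.cons (i : ℕ) fun j => (ν j : ℕ)) := by
  rw [← (Fin.consEquiv fun _ => Fin 3).sum_comp, Fintype.sum_prod_type]
  refine Finset.sum_congr rfl fun i _ => ?_
  rw [Finset.mul_sum]
  refine Finset.sum_congr rfl fun ν _ => ?_
  rw [Fin.prod_univ_succ]
  simp only [Fin.consEquiv_apply, Fin.cons_zero, Fin.cons_succ, mul_assoc]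
  congr 3
  ext j
  refine Fin.cases ?_ (fun j => ?_) j <;> simp

theorem IsMixedDerivFamily.norm_foldCoeff_le {s : ℕ} {Fd : (Fin s → ℕ) → (Fin s → ℝ) → ℝ}
    (h : IsMixedDerivFamily Fd) {B : (Fin s → ℕ) → ℝ}
    (hB : ∀ ν : Fin s → ℕ, (∀ i, ν i ≤ 2) → ∀ x : Fin s → ℝ,
      (∀ i, x i ∈ Set.Icc (0 : ℝ) 1) → |Fd ν x| ≤ B ν) (n : Fin s → ℤ) :
    ‖foldCoeff (Fd 0) n‖ ≤
      ∑ ν : Fin s → Fin 3, (∏ j, decayWeight (n j) (ν j)) * B fun j => (ν j : ℕ) := by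
  induction s with
  | zero =>
    refine (norm_integral_le_of_norm_le_const (C := B 0) (.of_forall fun x => ?_)).trans ?_
    · rw [norm_mul, Complex.norm_real, Real.norm_eq_abs]
      exact (mul_le_of_le_one_left (abs_nonneg _) (norm_mFourier_apply _ _)).trans
        (hB 0 (by simp) _ (foldTorus_mem x))
    · simp only [probReal_univ, Finset.univ_unique, Finset.univ_eq_empty, Finset.prod_empty,
        Finset.sum_singleton, one_mul, mul_one]
      exact (congrArg B (Subsingleton.elim _ _)).le
  | succ s ih =>
    set S : Fin 3 → ℝ := fun i => ∑ ν : Fin s → Fin 3,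
      (∏ j : Fin s, decayWeight (n j.succ) (ν j)) * B (Fin.cons (i : ℕ) fun j => (ν j : ℕ)) with hS
    have key : ∀ i : Fin 3, ∀ t ∈ Set.Icc (0 : ℝ) 1,
        ‖foldCoeff (fun y => Fd (Fin.cons (i : ℕ) 0) (Fin.cons t y)) (Fin.tail n)‖ ≤ S i := by
      intro i t ht
      have hi : (i : ℕ) ≤ 2 := by omega
      refine ih (h.slice hi t) (B := fun ν => B (Fin.cons (i : ℕ) ν)) (fun ν hν x hx => ?_) _
      exact hB _ (fun j => Fin.cases (by simpa using hi) (fun j => by simpa using hν j) j) _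
        (fun j => Fin.cases (by simpa using ht) (fun j => by simpa using hx j) j)
    rw [sum_prod_cons (fun j => decayWeight (n j)) B]
    change _ ≤ ∑ i : Fin 3, decayWeight (n 0) i * S i
    rw [Fin.sum_univ_three]
    have h0 : (Fin.cons 0 0 : Fin (s + 1) → ℕ) = 0 := Fin.cons_self_tail 0
    by_cases hn : n 0 = 0
    · have := foldCoeff_succ (h.continuous 0 (by simp)) n
      simp only [decayWeight, hn, if_true, one_mul, Fin.reduceEq, if_false, zero_mul, add_zero]
      rw [this]
      refine norm_integral_fourier_mul_le fun a => ?_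
      simpa [h0] using key 0 _ (two_mul_norm_mem_Icc a)
    · have hc2 : Continuous (Fd (Fin.cons 2 0)) := h.continuous _
        fun i => Fin.cases (by simp) (fun i => by simp) i
      have k1 := key 1 1 (by simp)
      have k0 := key 1 0 (by simp)
      have k2 : ‖foldCoeff (Fd (Fin.cons 2 0)) n‖ ≤ S 2 := by
        rw [foldCoeff_succ hc2]
        exact norm_integral_fourier_mul_le fun a => key 2 _ (two_mul_norm_mem_Icc a)
      have hS1 : 0 ≤ S 1 := (norm_nonneg _).trans k1
      have hS2 : 0 ≤ S 2 := (norm_nonneg _).trans k2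
      simp only [decayWeight, hn, if_true, if_false, Fin.reduceEq, zero_mul, zero_add]
      rw [h.foldCoeff_eq hn, norm_mul, Complex.norm_real]
      have hn' : 0 < ((n 0 : ℤ) : ℝ) ^ 2 := by positivity
      have hk : ‖(1 / (π * n 0) ^ 2 : ℝ)‖ ≤ 1 / (2 * ((n 0 : ℤ) : ℝ) ^ 2) := by
        rw [Real.norm_of_nonneg (by positivity), mul_pow]
        have : 2 ≤ π ^ 2 := by nlinarith [pi_gt_three]
        gcongr
      have hb : ‖((cos (π * n 0) : ℝ) : ℂ) *
          foldCoeff (fun y => Fd (Fin.cons 1 0) (Fin.cons 1 y)) (Fin.tail n) -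
          foldCoeff (fun y => Fd (Fin.cons 1 0) (Fin.cons 0 y)) (Fin.tail n) -
          foldCoeff (Fd (Fin.cons 2 0)) n‖ ≤ 2 * S 1 + S 2 := by
        refine (norm_sub_le _ _).trans (add_le_add ((norm_sub_le _ _).trans ?_) k2)
        rw [two_mul]
        refine add_le_add ?_ k0
        rw [norm_mul, Complex.norm_real]
        exact (mul_le_of_le_one_left (norm_nonneg _) (abs_cos_le_one _)).trans k1
      calc _ ≤ 1 / (2 * ((n 0 : ℤ) : ℝ) ^ 2) * (2 * S 1 + S 2) := by gcongr
        _ = 1 / ((n 0 : ℤ) : ℝ) ^ 2 * S 1 + 1 / ((n 0 : ℤ) : ℝ) ^ 2 * S 2 / 2 := by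
          field_simp
        _ ≤ _ := by
          have : 0 ≤ 1 / ((n 0 : ℤ) : ℝ) ^ 2 * S 2 := by positivity
          linarith

theorem card_intCast_mul_eq_zero_le (a : ℤ) (N : ℕ) [NeZero N] :
    Nat.card {x : ZMod N // (a : ZMod N) * x = 0} ≤ Int.gcd a N := by
  have hpos : 0 < Int.gcd a N := Int.gcd_pos_of_ne_zero_right _ (by exact_mod_cast NeZero.ne N)
  refine le_trans ?_ (IsAddCyclic.card_nsmul_eq_zero_le (α := ZMod N) hpos)
  rw [Nat.card_eq_fintype_card, Fintype.card_subtype]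
  refine Finset.card_le_card fun x hx => ?_
  simp only [Finset.mem_filter, Finset.mem_univ, true_and, nsmul_eq_mul] at hx ⊢
  have h : ((Int.gcd a N : ℤ) : ZMod N) = a * (Int.gcdA a N : ZMod N) := by
    rw [Int.gcd_eq_gcd_ab]; simp
  rw [Int.cast_natCast] at h
  rw [h, mul_right_comm, hx, zero_mul]

theorem card_dual_mul_le {s : ℕ} (N : ℕ) [NeZero N] (n : Fin s → ℤ) (j : Fin s) :
    Nat.card {z : Fin s → ZMod N // ∑ i, (n i : ZMod N) * z i = 0} * N ≤
      N ^ s * Int.gcd (n j) N := by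
  let φ : (Fin s → ZMod N) →+ ZMod N :=
    { toFun := fun z => ∑ i, (n i : ZMod N) * z i
      map_zero' := by simp
      map_add' := fun x y => by simp [mul_add, Finset.sum_add_distrib] }
  let ψ : ZMod N →+ ZMod N := AddMonoidHom.mulLeft (n j : ZMod N)
  have hφ := φ.ker.card_mul_index
  have hψ := ψ.ker.card_mul_index
  rw [AddSubgroup.index_ker] at hφ hψ
  have hr : Nat.card ψ.range ≤ Nat.card φ.range := by
    refine Nat.card_mono (Set.toFinite _) ?_
    rintro _ ⟨x, rfl⟩
    refine ⟨Pi.single j x, ?_⟩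
    change ∑ i, (n i : ZMod N) * (Pi.single j x : Fin s → ZMod N) i = n j * x
    rw [Finset.sum_eq_single j (fun i _ hij => by simp [Pi.single_eq_of_ne hij]) (by simp)]
    simp
  have h1 : Nat.card φ.ker = Nat.card {z : Fin s → ZMod N // ∑ i, (n i : ZMod N) * z i = 0} :=
    rfl
  have h2 : Nat.card ψ.ker ≤ Int.gcd (n j) N := card_intCast_mul_eq_zero_le (n j) N
  rw [Nat.card_zmod] at hψ
  rw [Nat.card_fun, Nat.card_zmod, Nat.card_fin] at hφ
  rw [← h1]
  calc Nat.card φ.ker * N = Nat.card φ.ker * (Nat.card ψ.ker * Nat.card ψ.range) := by rw [hψ]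
    _ ≤ Nat.card φ.ker * (Int.gcd (n j) N * Nat.card φ.range) := by gcongr
    _ = N ^ s * Int.gcd (n j) N := by rw [← hφ]; ring

theorem tsum_one_div_int_sq_le : ∑' n : ℤ, ENNReal.ofReal (1 / (n : ℝ) ^ 2) ≤ 4 := by
  have hnat : ∑' n : ℕ, ENNReal.ofReal (1 / (n : ℝ) ^ 2) ≤ 2 := by
    rw [← ENNReal.ofReal_tsum_of_nonneg (fun n => by positivity) hasSum_zeta_two.summable,
      hasSum_zeta_two.tsum_eq]
    refine ENNReal.ofReal_le_of_le_toReal ?_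
    norm_num
    nlinarith [pi_lt_d2, pi_pos]
  rw [tsum_of_nat_of_neg_add_one ENNReal.summable ENNReal.summable]
  have h2 : ∑' n : ℕ, ENNReal.ofReal (1 / (((-((n : ℤ) + 1) : ℤ)) : ℝ) ^ 2) ≤
      ∑' n : ℕ, ENNReal.ofReal (1 / (n : ℝ) ^ 2) := by
    refine le_trans (le_of_eq ?_) (ENNReal.tsum_comp_le_tsum_of_injective (f := fun n => n + 1)
      (add_left_injective 1) (fun n : ℕ => ENNReal.ofReal (1 / (n : ℝ) ^ 2)))
    refine tsum_congr fun n => ?_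
    push_cast
    rw [neg_sq]
  calc _ ≤ (2 : ENNReal) + 2 := add_le_add (by simpa using hnat) (h2.trans hnat)
    _ = 4 := by norm_num

theorem tsum_dvd_div_sq_le {q : ℕ} (hq : q ≠ 0) :
    ∑' n : ℤ, (if (q : ℤ) ∣ n then (q : ENNReal) else 0) * ENNReal.ofReal (1 / (n : ℝ) ^ 2) ≤
      (q : ENNReal)⁻¹ * 4 := by
  have hinj : Function.Injective fun l : ℤ => (q : ℤ) * l :=
    mul_right_injective₀ (by exact_mod_cast hq)
  rw [← hinj.tsum_eq]
  · refine le_trans (le_of_eq ?_) (mul_le_mul_right tsum_one_div_int_sq_le _)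
    rw [← ENNReal.tsum_mul_left]
    refine tsum_congr fun l => ?_
    have hq' : (0 : ℝ) < q := by positivity
    simp only [dvd_mul_right, if_true]
    rw [← ENNReal.ofReal_natCast q, ← ENNReal.ofReal_inv_of_pos hq',
      ← ENNReal.ofReal_mul hq'.le, ← ENNReal.ofReal_mul (by positivity)]
    congr 1
    push_cast
    field_simp
  · intro n hn
    by_contra h
    refine hn ?_
    have : ¬ (q : ℤ) ∣ n := fun ⟨l, hl⟩ => h ⟨l, hl.symm⟩
    simp [this]

/-- The gcd with `N`, set to `1` at zero. -/
def gcdWeight (N : ℕ) (n : ℤ) : ℕ := if n = 0 then 1 else Int.gcd n N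

theorem one_le_gcdWeight (N : ℕ) [NeZero N] (n : ℤ) : 1 ≤ gcdWeight N n := by
  unfold gcdWeight
  split_ifs
  · exact le_rfl
  · exact Int.gcd_pos_of_ne_zero_right _ (by exact_mod_cast NeZero.ne N)

theorem gcd_pow_le_sum {b : ℕ} (hb : b.Prime) (m : ℕ) (n : ℤ) :
    (Int.gcd n (b ^ m : ℕ) : ENNReal) ≤
      ∑ k ∈ Finset.range (m + 1), if ((b ^ k : ℕ) : ℤ) ∣ n then ((b ^ k : ℕ) : ENNReal) else 0 := by
  have hd : Int.gcd n (b ^ m : ℕ) ∣ b ^ m := by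
    exact_mod_cast Int.gcd_dvd_right n ((b ^ m : ℕ) : ℤ)
  obtain ⟨k, hk, hk'⟩ := (Nat.dvd_prime_pow hb).1 hd
  have hdvd : ((b ^ k : ℕ) : ℤ) ∣ n := by rw [← hk']; exact Int.gcd_dvd_left _ _
  refine le_trans (le_of_eq ?_) (Finset.single_le_sum (fun _ _ => zero_le)
    (Finset.mem_range.2 (Nat.lt_succ_of_le hk)))
  rw [if_pos hdvd, hk']

theorem tsum_decayWeight_mul_gcdWeight_le {b : ℕ} (hb : b.Prime) (m : ℕ) (i : Fin 3) :
    ∑' n : ℤ, ENNReal.ofReal (decayWeight n i) * (gcdWeight (b ^ m) n : ENNReal) ≤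
      if i = 0 then 1 else 8 := by
  split_ifs with hi
  · rw [tsum_eq_single 0 fun n hn => by simp [decayWeight, hn, hi]]
    simp [decayWeight, gcdWeight, hi]
  · calc ∑' n : ℤ, ENNReal.ofReal (decayWeight n i) * (gcdWeight (b ^ m) n : ENNReal)
        ≤ ∑' n : ℤ, ∑ k ∈ Finset.range (m + 1),
          (if ((b ^ k : ℕ) : ℤ) ∣ n then ((b ^ k : ℕ) : ENNReal) else 0) *
            ENNReal.ofReal (1 / (n : ℝ) ^ 2) := by
          refine ENNReal.tsum_le_tsum fun n => ?_
          by_cases hn : n = 0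
          · simp [decayWeight, hn, hi]
          · rw [← Finset.sum_mul, mul_comm]
            simp only [decayWeight, gcdWeight, hn, hi, if_false]
            exact mul_le_mul_left (gcd_pow_le_sum hb m n) _
      _ = ∑ k ∈ Finset.range (m + 1), ∑' n : ℤ,
          (if ((b ^ k : ℕ) : ℤ) ∣ n then ((b ^ k : ℕ) : ENNReal) else 0) *
            ENNReal.ofReal (1 / (n : ℝ) ^ 2) :=
          Summable.tsum_finsetSum fun _ _ => ENNReal.summable
      _ ≤ ∑ k ∈ Finset.range (m + 1), (2 : ENNReal)⁻¹ ^ k * 4 := by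
          refine Finset.sum_le_sum fun k _ =>
            (tsum_dvd_div_sq_le (pow_ne_zero k hb.ne_zero)).trans ?_
          rw [← ENNReal.inv_pow]
          refine mul_le_mul_left (ENNReal.inv_le_inv.2 ?_) _
          exact_mod_cast Nat.pow_le_pow_left hb.two_le k
      _ ≤ (∑' k, (2 : ENNReal)⁻¹ ^ k) * 4 := by
          rw [← Finset.sum_mul]
          exact mul_le_mul_left (ENNReal.sum_le_tsum _) _
      _ = 8 := by
          rw [ENNReal.tsum_geometric, ENNReal.one_sub_inv_two, inv_inv]
          norm_num

theorem ENNReal.tsum_pi_prod {s : ℕ} {α : Type*} (f : Fin s → α → ENNReal) :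
    ∑' n : Fin s → α, ∏ j, f j (n j) = ∏ j, ∑' a, f j a := by
  induction s with
  | zero => simp
  | succ s ih =>
    rw [← (Fin.consEquiv fun _ => α).tsum_eq, ENNReal.tsum_prod', Fin.prod_univ_succ, ← ih,
      ← ENNReal.tsum_mul_right]
    refine tsum_congr fun a => ?_
    rw [← ENNReal.tsum_mul_left]
    refine tsum_congr fun n => ?_
    rw [Fin.prod_univ_succ]
    simp

theorem integrableOn_pow_mul_exp_neg (n : ℕ) :
    IntegrableOn (fun t : ℝ => exp (-t) * t ^ n) (Set.Ioi 0) := by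
  have := GammaIntegral_convergent (s := n + 1) (by positivity)
  simpa using this

theorem integral_pow_mul_exp_neg (n : ℕ) :
    ∫ t in Set.Ioi (0 : ℝ), exp (-t) * t ^ n = n.factorial := by
  rw [← Real.Gamma_nat_eq_factorial, Real.Gamma_eq_integral (by positivity)]
  simp

theorem sum_factorial_mul_prod_le {s : ℕ} {x : Fin s → ℝ} (hx : ∀ j, 0 ≤ x j) {K : ℝ}
    (hK : 2 ≤ K) (hsum : K * ∑ j, x j < 1) :
    ∑ ν : Fin s → Fin 3, ((∑ j, (ν j : ℕ)).factorial : ℝ) *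
      ∏ j, ((if ν j = 0 then 1 else K) * x j ^ (ν j : ℕ)) ≤ (1 - K * ∑ j, x j)⁻¹ := by
  set κ : Fin 3 → ℝ := fun i => if i = 0 then 1 else K
  set P : (Fin s → Fin 3) → ℝ := fun ν => ∏ j, (κ (ν j) * x j ^ (ν j : ℕ)) with hP
  have hlt : -(1 - K * ∑ j, x j) < 0 := by linarith
  have hint : ∀ ν : Fin s → Fin 3, IntegrableOn
      (fun t : ℝ => exp (-t) * t ^ (∑ j, (ν j : ℕ)) * P ν) (Set.Ioi 0) := fun ν =>
    (integrableOn_pow_mul_exp_neg _).mul_const _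
  calc ∑ ν : Fin s → Fin 3, ((∑ j, (ν j : ℕ)).factorial : ℝ) * P ν
      = ∫ t in Set.Ioi (0 : ℝ), ∑ ν : Fin s → Fin 3,
          exp (-t) * t ^ (∑ j, (ν j : ℕ)) * P ν := by
        rw [integral_finsetSum _ fun ν _ => hint ν]
        refine Finset.sum_congr rfl fun ν _ => ?_
        rw [integral_mul_const, integral_pow_mul_exp_neg]
    _ ≤ ∫ t in Set.Ioi (0 : ℝ), exp (-(1 - K * ∑ j, x j) * t) := by
        refine setIntegral_mono_on (integrable_finsetSum _ fun ν _ => hint ν)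
          (integrableOn_exp_mul_Ioi hlt 0) measurableSet_Ioi fun t ht => ?_
        have ht0 : 0 ≤ t := le_of_lt ht
        have e : ∀ ν : Fin s → Fin 3, exp (-t) * t ^ (∑ j, (ν j : ℕ)) * P ν =
            exp (-t) * ∏ j, (κ (ν j) * (x j * t) ^ (ν j : ℕ)) := by
          intro ν
          simp only [hP, mul_pow, Finset.prod_mul_distrib, Finset.prod_pow_eq_pow_sum]
          ring
        simp only [e]
        rw [← Finset.mul_sum, ← Fintype.piFinset_univ,
          ← Finset.prod_univ_sum (fun _ => Finset.univ) fun j i => κ i * (x j * t) ^ (i : ℕ)]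
        have hle : ∏ j, ∑ i : Fin 3, κ i * (x j * t) ^ (i : ℕ) ≤ ∏ j, exp (K * x j * t) := by
          refine Finset.prod_le_prod (fun j _ => Finset.sum_nonneg fun i _ => ?_) fun j _ => ?_
          · have := hx j
            have : 0 ≤ κ i := by simp only [κ]; split_ifs <;> linarith
            positivity
          · have h1 := hx j
            have h2 : 0 ≤ x j * t := by positivity
            refine le_trans ?_ (quadratic_le_exp_of_nonneg (x := K * x j * t) (by positivity))
            simp [Fin.sum_univ_three, κ]
            have : 0 ≤ K * (K - 2) * (x j * t) ^ 2 := by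
              have : 0 ≤ K - 2 := by linarith
              positivity
            nlinarith
        calc exp (-t) * ∏ j, ∑ i : Fin 3, κ i * (x j * t) ^ (i : ℕ)
            ≤ exp (-t) * ∏ j, exp (K * x j * t) := by gcongr
          _ = exp (-(1 - K * ∑ j, x j) * t) := by
            rw [← exp_sum, ← exp_add, ← Finset.sum_mul, ← Finset.mul_sum]
            congr 1
            ring
    _ = (1 - K * ∑ j, x j)⁻¹ := by
        rw [integral_exp_mul_Ioi hlt, mul_zero, exp_zero, neg_div_neg_eq, one_div]

theorem inv_le_one_div_twenty {b : ℕ} (hb : 2 ≤ b) :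
    (4 * max (2 / (2 * Real.sin (π / b)) ^ 2) (1 / (2 * Real.sin (π / b))) *
        (3 + 2 / (b : ℝ) + (2 * (b : ℝ) + 1) / ((b : ℝ) - 1)) * (2 + 1 / (b : ℝ)))⁻¹ ≤
      1 / 20 := by
  have hb' : (2 : ℝ) ≤ b := by exact_mod_cast hb
  have hsin : 0 < Real.sin (π / b) := by
    refine sin_pos_of_pos_of_lt_pi (by positivity) ?_
    exact div_lt_self pi_pos (by linarith)
  have h1 : 1 / 2 ≤ max (2 / (2 * Real.sin (π / b)) ^ 2) (1 / (2 * Real.sin (π / b))) := by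
    refine le_max_of_le_right ?_
    have := Real.sin_le_one (π / b)
    gcongr
    linarith
  have h2 : 5 ≤ 3 + 2 / (b : ℝ) + (2 * (b : ℝ) + 1) / ((b : ℝ) - 1) := by
    have : 2 ≤ (2 * (b : ℝ) + 1) / ((b : ℝ) - 1) := by
      rw [le_div_iff₀ (by linarith)]
      linarith
    have : 0 ≤ 2 / (b : ℝ) := by positivity
    linarith
  have h3 : 2 ≤ 2 + 1 / (b : ℝ) := by
    have : 0 ≤ 1 / (b : ℝ) := by positivity
    linarith
  rw [one_div (20 : ℝ)]
  refine inv_anti₀ (by norm_num) ?_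
  calc (20 : ℝ) = 4 * (1 / 2) * 5 * 2 := by norm_num
    _ ≤ _ := by gcongr

theorem foldCoeff_zero {s : ℕ} {F : (Fin s → ℝ) → ℝ} (hF : Continuous F) :
    foldCoeff F 0 =
      ((∫ x in Set.univ.pi fun _ : Fin s => Set.Icc (0 : ℝ) 1, F x : ℝ) : ℂ) := by
  have h : MeasurePreserving (foldTorus (s := s)) (torusHaar s)
      (volume.restrict (Set.univ.pi fun _ : Fin s => Set.Icc (0 : ℝ) 1)) := by
    rw [volume_pi, Measure.restrict_pi_pi]
    exact measurePreserving_pi _ _ fun _ => measurePreserving_two_mul_norm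
  rw [← h.map_eq, integral_map h.measurable.aemeasurable hF.aestronglyMeasurable,
    ← integral_complex_ofReal]
  simp [foldCoeff, UnitAddTorus.mFourier_zero]

/-- The points of the rank-one lattice rule with generating vector `z`. -/
noncomputable def latticePoint {s N : ℕ} [NeZero N] (z : Fin s → ZMod N) (k : ZMod N) :
    UnitAddTorus (Fin s) := fun j => ZMod.toAddCircle (k * z j)

theorem mFourier_latticePoint {s N : ℕ} [NeZero N] (z : Fin s → ZMod N) (k : ZMod N)
    (n : Fin s → ℤ) :
    UnitAddTorus.mFourier n (latticePoint z k) =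
      ZMod.stdAddChar (k * ∑ i, (n i : ZMod N) * z i) := by
  have h : ∀ (a : ℤ) (x : ZMod N), fourier a (ZMod.toAddCircle x : UnitAddCircle) =
      ZMod.stdAddChar ((a : ZMod N) * x) := by
    intro a x
    rw [fourier_apply, ← map_zsmul, zsmul_eq_mul]
    rfl
  simp only [UnitAddTorus.mFourier, ContinuousMap.coe_mk, latticePoint, h, Finset.mul_sum,
    mul_left_comm _ k]
  exact (map_prod (ZMod.stdAddChar (N := N)).toMonoidHom
    (fun i => Multiplicative.ofAdd (k * ((n i : ZMod N) * z i))) Finset.univ).symm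

theorem sum_mFourier_latticePoint {s N : ℕ} [NeZero N] (z : Fin s → ZMod N) (n : Fin s → ℤ) :
    ∑ k, UnitAddTorus.mFourier n (latticePoint z k) =
      if ∑ i, (n i : ZMod N) * z i = 0 then (N : ℂ) else 0 := by
  simp only [mFourier_latticePoint]
  rw [AddChar.sum_mulShift _ (ZMod.isPrimitive_stdAddChar N), ZMod.card]
  push_cast
  rfl

theorem enorm_lattice_error_le {s N : ℕ} [NeZero N] (z : Fin s → ZMod N)
    {F : (Fin s → ℝ) → ℝ} (hF : Continuous F) {M : (Fin s → ℤ) → ENNReal}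
    (hM : ∀ n, ‖foldCoeff F n‖ₑ ≤ M n) (hsum : ∑' n, M n ≠ ⊤) :
    ‖1 / (N : ℝ) * ∑ k, F (foldTorus (latticePoint z k)) -
        ∫ x in Set.univ.pi fun _ : Fin s => Set.Icc (0 : ℝ) 1, F x‖ₑ ≤
      ∑' n, if n ≠ 0 ∧ ∑ i, (n i : ZMod N) * z i = 0 then M n else 0 := by
  have hN : (N : ℂ) ≠ 0 := by exact_mod_cast NeZero.ne N
  let G : C(UnitAddTorus (Fin s), ℂ) := ⟨fun x => (F (foldTorus x) : ℂ), by fun_prop⟩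
  have hsummable : Summable (UnitAddTorus.mFourierCoeff G) := by
    refine Summable.of_norm ?_
    refine (ENNReal.summable_toReal hsum).of_nonneg_of_le (fun _ => norm_nonneg _) fun n => ?_
    rw [← toReal_enorm]
    exact ENNReal.toReal_mono (ENNReal.ne_top_of_tsum_ne_top hsum n) (hM n)
  have h1 := (hasSum_sum (s := Finset.univ) fun k _ =>
    UnitAddTorus.hasSum_mFourier_series_apply_of_summable hsummable (latticePoint z k)).mul_left
    (1 / (N : ℂ))
  have h2 := h1.sub (hasSum_ite_eq (0 : Fin s → ℤ) (foldCoeff F 0))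
  have h3 : ∀ n : Fin s → ℤ, 1 / (N : ℂ) * ∑ k, UnitAddTorus.mFourierCoeff G n •
      UnitAddTorus.mFourier n (latticePoint z k) - (if n = 0 then foldCoeff F 0 else 0) =
      if n ≠ 0 ∧ ∑ i, (n i : ZMod N) * z i = 0 then foldCoeff F n else 0 := by
    intro n
    have : UnitAddTorus.mFourierCoeff G n = foldCoeff F n := rfl
    simp only [smul_eq_mul]
    rw [← Finset.mul_sum, sum_mFourier_latticePoint, this]
    by_cases hn : n = 0
    · subst hn
      simp
      field_simp
      simp
    · by_cases hz : ∑ i, (n i : ZMod N) * z i = 0 <;> simp [hn, hz]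
      field_simp
  simp only [h3] at h2
  have h4 : ((1 / (N : ℝ) * ∑ k, F (foldTorus (latticePoint z k)) -
        ∫ x in Set.univ.pi fun _ : Fin s => Set.Icc (0 : ℝ) 1, F x : ℝ) : ℂ) =
      1 / (N : ℂ) * ∑ k, G (latticePoint z k) - foldCoeff F 0 := by
    rw [foldCoeff_zero hF]
    push_cast
    rfl
  rw [← enorm_norm, ← Complex.norm_real, enorm_norm, h4, ← h2.tsum_eq]
  refine enorm_tsum_le_tsum_enorm.trans (ENNReal.tsum_le_tsum fun n => ?_)
  split_ifs
  · exact hM n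
  · simp

theorem exists_lattice_generator {s N : ℕ} [NeZero N] {M : (Fin s → ℤ) → ENNReal} {K : ENNReal}
    (hM : ∑' n, M n * ∏ j, (gcdWeight N (n j) : ENNReal) ≤ K) :
    ∃ z : Fin s → ZMod N,
      (∑' n, if n ≠ 0 ∧ ∑ i, (n i : ZMod N) * z i = 0 then M n else 0) * N ≤ K := by
  have hcard : ∀ n : Fin s → ℤ,
      (∑ z : Fin s → ZMod N, if n ≠ 0 ∧ ∑ i, (n i : ZMod N) * z i = 0 then M n else 0) * N ≤
        (N : ENNReal) ^ s * (M n * ∏ j, (gcdWeight N (n j) : ENNReal)) := by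
    intro n
    by_cases hn : n = 0
    · simp [hn]
    · obtain ⟨j, hj⟩ := Function.ne_iff.1 hn
      have h1 := card_dual_mul_le N n j
      have h2 : Int.gcd (n j) N ≤ ∏ j, gcdWeight N (n j) := by
        have : Int.gcd (n j) N = gcdWeight N (n j) := (if_neg hj).symm
        rw [this]
        exact Finset.single_le_prod' (fun i _ => one_le_gcdWeight N (n i)) (Finset.mem_univ j)
      have h3 := h1.trans (Nat.mul_le_mul_left (N ^ s) h2)
      have h4 : (Nat.card {z : Fin s → ZMod N // ∑ i, (n i : ZMod N) * z i = 0} : ENNReal) * N ≤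
          (N : ENNReal) ^ s * ∏ j, (gcdWeight N (n j) : ENNReal) := by exact_mod_cast h3
      simp only [ne_eq, hn, not_false_eq_true, true_and]
      rw [← Finset.sum_filter, Finset.sum_const, nsmul_eq_mul, ← Fintype.card_subtype,
        ← Nat.card_eq_fintype_card]
      calc _ = M n * ((Nat.card {z : Fin s → ZMod N // ∑ i, (n i : ZMod N) * z i = 0} : ENNReal) *
            N) := by ring
        _ ≤ M n * ((N : ENNReal) ^ s * ∏ j, (gcdWeight N (n j) : ENNReal)) := by gcongr
        _ = _ := by ring
  have htotal : ∑ z : Fin s → ZMod N,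
      (∑' n, if n ≠ 0 ∧ ∑ i, (n i : ZMod N) * z i = 0 then M n else 0) * N ≤
      ∑ _z : Fin s → ZMod N, K := by
    rw [← Finset.sum_mul, ← Summable.tsum_finsetSum fun _ _ => ENNReal.summable,
      ← ENNReal.tsum_mul_right]
    refine (ENNReal.tsum_le_tsum hcard).trans ?_
    rw [ENNReal.tsum_mul_left, Finset.sum_const, nsmul_eq_mul, Finset.card_univ]
    simp only [Fintype.card_pi, ZMod.card, Finset.prod_const, Finset.card_univ, Fintype.card_fin]
    push_cast
    gcongr
  by_contra! h
  exact (ENNReal.sum_lt_sum_of_nonempty Finset.univ_nonempty fun z _ => h z).not_ge htotal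

/-- The bound `|ν|! ∏ βⱼ ^ νⱼ` on the mixed derivatives. -/
noncomputable def spodBound {s : ℕ} (x : Fin s → ℝ) (ν : Fin s → ℕ) : ℝ :=
  ((∑ i, ν i).factorial : ℝ) * ∏ i, x i ^ ν i

theorem spodBound_nonneg {s : ℕ} {x : Fin s → ℝ} (hx : ∀ j, 0 ≤ x j) (ν : Fin s → ℕ) :
    0 ≤ spodBound x ν :=
  mul_nonneg (by positivity) (Finset.prod_nonneg fun i _ => pow_nonneg (hx i) _)

/-- The bound on the Fourier coefficients obtained from `spodBound`. -/
noncomputable def spodCoeffBound {s : ℕ} (x : Fin s → ℝ) (n : Fin s → ℤ) : ℝ :=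
  ∑ ν : Fin s → Fin 3, (∏ j, decayWeight (n j) (ν j)) * spodBound x fun j => (ν j : ℕ)

theorem tsum_spodCoeffBound_le {s b : ℕ} (hb : b.Prime) (m : ℕ) {x : Fin s → ℝ}
    (hx : ∀ j, 0 ≤ x j) (hsum : 8 * ∑ j, x j < 1) :
    ∑' n, ENNReal.ofReal (spodCoeffBound x n) * ∏ j, (gcdWeight (b ^ m) (n j) : ENNReal) ≤
      ENNReal.ofReal (1 - 8 * ∑ j, x j)⁻¹ := by
  have hterm : ∀ n : Fin s → ℤ,
      ENNReal.ofReal (spodCoeffBound x n) * ∏ j, (gcdWeight (b ^ m) (n j) : ENNReal) =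
      ∑ ν : Fin s → Fin 3, ENNReal.ofReal (spodBound x fun j => (ν j : ℕ)) *
        ∏ j, (ENNReal.ofReal (decayWeight (n j) (ν j)) * (gcdWeight (b ^ m) (n j) : ENNReal)) := by
    intro n
    have h0 : ∀ ν : Fin s → Fin 3, 0 ≤ ∏ j, decayWeight (n j) (ν j) :=
      fun ν => Finset.prod_nonneg fun j _ => decayWeight_nonneg _ _
    rw [spodCoeffBound, ENNReal.ofReal_sum_of_nonneg fun ν _ =>
      mul_nonneg (h0 ν) (spodBound_nonneg hx _), Finset.sum_mul]
    refine Finset.sum_congr rfl fun ν _ => ?_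
    rw [ENNReal.ofReal_mul (h0 ν),
      ENNReal.ofReal_prod_of_nonneg fun j _ => decayWeight_nonneg _ _, Finset.prod_mul_distrib]
    ring
  simp only [hterm]
  rw [Summable.tsum_finsetSum fun _ _ => ENNReal.summable]
  calc _ ≤ ∑ ν : Fin s → Fin 3, ENNReal.ofReal (spodBound x fun j => (ν j : ℕ)) *
        ∏ j, ENNReal.ofReal (if ν j = 0 then 1 else 8) := by
        refine Finset.sum_le_sum fun ν _ => ?_
        rw [ENNReal.tsum_mul_left, ENNReal.tsum_pi_prod fun j a =>
          ENNReal.ofReal (decayWeight a (ν j)) * (gcdWeight (b ^ m) a : ENNReal)]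
        gcongr with j
        refine (tsum_decayWeight_mul_gcdWeight_le hb m (ν j)).trans_eq ?_
        split_ifs <;> simp
    _ = ENNReal.ofReal (∑ ν : Fin s → Fin 3, ((∑ j, (ν j : ℕ)).factorial : ℝ) *
          ∏ j, ((if ν j = 0 then 1 else 8) * x j ^ (ν j : ℕ))) := by
        have h8 : ∀ i : Fin 3, (0 : ℝ) ≤ if i = 0 then 1 else 8 := fun i => by
          split_ifs <;> norm_num
        rw [ENNReal.ofReal_sum_of_nonneg fun ν _ => mul_nonneg (by positivity)
          (Finset.prod_nonneg fun j _ => mul_nonneg (h8 _) (pow_nonneg (hx j) _))]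
        refine Finset.sum_congr rfl fun ν _ => ?_
        rw [← ENNReal.ofReal_prod_of_nonneg fun j _ => h8 _,
          ← ENNReal.ofReal_mul (spodBound_nonneg hx _), spodBound, Finset.prod_mul_distrib]
        congr 1
        ring
    _ ≤ _ := ENNReal.ofReal_le_ofReal (sum_factorial_mul_prod_le hx (by norm_num) hsum)

/-- **Main result (Theorem 3.1), case `p = 1`.**
Let `(β_j)` be nonnegative and summable with
`∑ β_j < (4·max(2/(2 sin(π/b))², 1/(2 sin(π/b)))·(3 + 2/b + (2b+1)/(b-1))·(2 + 1/b))⁻¹`,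
let `b` be prime and `α := 2`.  Then there is a constant `C` (depending only
on `β` and `b`) such that for all `s, m ≥ 1` with `N = b^m` there are QMC
points `y₀, …, y_{N-1} ∈ [0,1]^s` with the property: for every `c > 0` and
every `F : [0,1]^s → ℝ` with continuous mixed partial derivatives of order up
to `2` in each variable (witnessed by the family `Fd ν = ∂^ν F`, where
consecutive partial derivatives are line derivatives along the coordinate
directions) satisfying `|∂^ν F(y)| ≤ c·|ν|!·∏ β_j^{ν_j}` on the cube for all
`ν ∈ {0,1,2}^s`, the QMC quadrature error satisfies
`|N⁻¹ ∑_n F(y_n) − ∫_{[0,1]^s} F| ≤ c·C·N⁻¹`. -/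
theorem higher_order_qmc_error_SPOD_p_one
    (β : ℕ → ℝ) (hβ : ∀ j, 0 ≤ β j) (hβsum : Summable β)
    (b : ℕ) (hb : Nat.Prime b)
    (hβsmall : (∑' j, β j) <
      (4 * max (2 / (2 * Real.sin (π / b)) ^ 2) (1 / (2 * Real.sin (π / b))) *
        (3 + 2 / (b : ℝ) + (2 * (b : ℝ) + 1) / ((b : ℝ) - 1)) *
        (2 + 1 / (b : ℝ)))⁻¹) :
    ∃ C : ℝ, 0 < C ∧
      ∀ s m : ℕ, 1 ≤ s → 1 ≤ m →
        ∃ y : Fin (b ^ m) → Fin s → ℝ,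
          (∀ n i, y n i ∈ Set.Icc (0 : ℝ) 1) ∧
          ∀ (c : ℝ), 0 < c →
          ∀ (F : (Fin s → ℝ) → ℝ) (Fd : (Fin s → ℕ) → (Fin s → ℝ) → ℝ),
            Fd 0 = F →
            (∀ ν : Fin s → ℕ, (∀ i, ν i ≤ 2) → Continuous (Fd ν)) →
            (∀ (ν : Fin s → ℕ) (j : Fin s), (∀ i, ν i ≤ 2) →
              ν j < 2 → ∀ x : Fin s → ℝ,
                HasLineDerivAt ℝ (Fd ν) (Fd (ν + Pi.single j 1) x) x
                  (Pi.single j 1)) →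
            (∀ ν : Fin s → ℕ, (∀ i, ν i ≤ 2) →
              ∀ x : Fin s → ℝ, (∀ i, x i ∈ Set.Icc (0 : ℝ) 1) →
                |Fd ν x| ≤
                  c * ((∑ i, ν i).factorial : ℝ) * ∏ i : Fin s, β i.1 ^ ν i) →
            |(1 / (b ^ m : ℝ)) * ∑ n, F (y n) -
                ∫ x in Set.univ.pi fun _ : Fin s => Set.Icc (0 : ℝ) 1, F x| ≤
              c * C * ((b : ℝ) ^ m)⁻¹ := by
  have hβ20 : ∑' j, β j < 1 / 20 := hβsmall.trans_le (inv_le_one_div_twenty hb.two_le)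
  refine ⟨2, two_pos, fun s m _ _ => ?_⟩
  have hN : NeZero (b ^ m) := ⟨pow_ne_zero m hb.ne_zero⟩
  have hx : ∀ j : Fin s, 0 ≤ β j := fun j => hβ j
  have hxsum : ∑ j : Fin s, β j ≤ 1 / 20 := by
    rw [Fin.sum_univ_eq_sum_range β s]
    exact (hβsum.sum_le_tsum _ fun j _ => hβ j).trans hβ20.le
  have hK : ∑' n, ENNReal.ofReal (spodCoeffBound (fun j : Fin s => β j) n) *
      ∏ j, (gcdWeight (b ^ m) (n j) : ENNReal) ≤ ENNReal.ofReal 2 := by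
    refine (tsum_spodCoeffBound_le hb m hx (by linarith)).trans (ENNReal.ofReal_le_ofReal ?_)
    rw [inv_le_comm₀ (by linarith) two_pos]
    linarith
  obtain ⟨z, hz⟩ := exists_lattice_generator hK
  let e : Fin (b ^ m) ≃ ZMod (b ^ m) := Fintype.equivOfCardEq (by simp [ZMod.card])
  refine ⟨fun k => foldTorus (latticePoint z (e k)), fun k i => foldTorus_mem _ i,
    fun c hc F Fd hF hcont hder hbound => ?_⟩
  have hfam : IsMixedDerivFamily Fd := ⟨hcont, hder⟩
  have hFc : Continuous F := hF ▸ hcont 0 (by simp)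
  have hcoeff : ∀ n, ‖foldCoeff F n‖ₑ ≤
      ENNReal.ofReal c * ENNReal.ofReal (spodCoeffBound (fun j : Fin s => β j) n) := by
    intro n
    rw [← ofReal_norm, ← ENNReal.ofReal_mul hc.le, ← hF]
    refine ENNReal.ofReal_le_ofReal ((hfam.norm_foldCoeff_le
      (B := fun ν => c * spodBound (fun j : Fin s => β j) ν) (fun ν hν x hx => ?_) n).trans_eq ?_)
    · exact (hbound ν hν x hx).trans_eq (mul_assoc _ _ _)
    · rw [spodCoeffBound, Finset.mul_sum]
      exact Finset.sum_congr rfl fun ν _ => mul_left_comm _ _ _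
  have hfin : ∑' n, ENNReal.ofReal c *
      ENNReal.ofReal (spodCoeffBound (fun j : Fin s => β j) n) ≠ ⊤ := by
    rw [ENNReal.tsum_mul_left]
    refine ENNReal.mul_ne_top ENNReal.ofReal_ne_top (ne_top_of_le_ne_top ENNReal.ofReal_ne_top
      (le_trans (ENNReal.tsum_le_tsum fun n => ?_) hK))
    refine le_mul_of_one_le_right' ?_
    exact_mod_cast Finset.one_le_prod' fun j _ => one_le_gcdWeight (b ^ m) (n j)
  have herr := enorm_lattice_error_le z hFc hcoeff hfin
  have hpos : (0 : ℝ) < (b : ℝ) ^ m := pow_pos (by exact_mod_cast hb.pos) m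
  have hmul : ENNReal.ofReal (|1 / (b ^ m : ℝ) * ∑ n, F (foldTorus (latticePoint z (e n))) -
      ∫ x in Set.univ.pi fun _ : Fin s => Set.Icc (0 : ℝ) 1, F x| * (b : ℝ) ^ m) ≤
      ENNReal.ofReal (c * 2) := by
    rw [e.sum_comp fun k => F (foldTorus (latticePoint z k)), ENNReal.ofReal_mul (abs_nonneg _),
      ← Real.norm_eq_abs, ofReal_norm, ENNReal.ofReal_mul hc.le]
    have hcast : ENNReal.ofReal ((b : ℝ) ^ m) = ((b ^ m : ℕ) : ENNReal) := by
      rw [← ENNReal.ofReal_natCast]; push_cast; rfl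
    rw [hcast]
    push_cast at herr hz ⊢
    refine (mul_le_mul_left herr _).trans (le_trans (le_of_eq ?_) (mul_le_mul_right hz _))
    rw [← mul_assoc, ← ENNReal.tsum_mul_left]
    simp only [mul_ite, mul_zero]
  rw [← div_eq_mul_inv, le_div_iff₀ hpos]
  exact (ENNReal.ofReal_le_ofReal_iff (by positivity)).1 hmul
end

section
/- Let 0 < p ≤ 1, let (β_j)_{j≥1} be nonnegative reals with Σ_{j≥1} β_j^p < ∞, let b be a prime, and set α := ⌊1/p⌋ + 1. Then there exists a constant C < ∞, depending only on α, (β_j), b and p, with the following property: for every integer s ≥ 1 and every integer m ≥ 1 with N := b^m, there exist points y₀, …, y_{N−1} ∈ [0,1]^s such that for every constant c > 0 and every function F : [0,1]^s → ℝ possessing continuous partial derivatives of order up to α in each variable and satisfying the product-form bound |(∂_y^ν F)(y)| ≤ c · ν! · ∏_{j=1}^s β_j^{ν_j} for all y ∈ [0,1]^s and all multi-indices ν ∈ {0,1,…,α}^s (where ν! := ∏_{j=1}^s ν_j!), the quadrature error satisfies | (1/N)·Σ_{n=0}^{N−1} F(y_n) − ∫_{[0,1]^s} F(y) dy | ≤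 c · C · N^{−1/p}. No smallness condition on Σ_{j≥1} β_j is required when p = 1. -/
open MeasureTheory

section Walsh

open Matrix

variable {I J : Type*} [Fintype I] [DecidableEq I] [Fintype J] [DecidableEq J]
  {b : ℕ} [Fact b.Prime]

set_option linter.unusedSectionVars false

/-- The additive character `x ↦ exp (2πi (k ⬝ x) / b)` of `(ZMod b)^I`. -/
noncomputable def walshChar (k : I → ZMod b) : AddChar (I → ZMod b) ℂ :=
  (ZMod.stdAddChar (N := b)).compAddMonoidHom
    { toFun := fun x => k ⬝ᵥ x
      map_zero' := dotProduct_zero k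
      map_add' := dotProduct_add k }

lemma walshChar_apply (k x : I → ZMod b) :
    walshChar k x = ZMod.stdAddChar (k ⬝ᵥ x) := rfl

lemma walshChar_comm (k x : I → ZMod b) : walshChar k x = walshChar x k := by
  simp only [walshChar_apply, dotProduct_comm]

lemma walshChar_single (k : I → ZMod b) (i : I) :
    walshChar k (Pi.single i 1) = ZMod.stdAddChar (k i) := by
  simp [walshChar_apply]

lemma stdAddChar_ne_one {a : ZMod b} (ha : a ≠ 0) : ZMod.stdAddChar a ≠ 1 := by
  rw [← (ZMod.stdAddChar (N := b)).map_zero_eq_one]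
  exact fun h => ha (ZMod.injective_stdAddChar h)

lemma walshChar_eq_zero_iff (k : I → ZMod b) : walshChar k = 0 ↔ k = 0 := by
  constructor
  · intro h
    ext i
    by_contra hi
    refine stdAddChar_ne_one hi ?_
    rw [← walshChar_single, h, AddChar.zero_apply]
  · rintro rfl
    ext x
    simp [walshChar_apply]

lemma sum_walshChar (k : I → ZMod b) :
    ∑ x, walshChar k x = if k = 0 then (b : ℂ) ^ Fintype.card I else 0 := by
  classical
  rw [AddChar.sum_eq_ite]
  simp [walshChar_eq_zero_iff, ZMod.card]

/-- The Walsh coefficients of a function on `(ZMod b)^I`. -/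
noncomputable def walshCoeff (f : (I → ZMod b) → ℝ) (k : I → ZMod b) : ℂ :=
  (∑ x, (f x : ℂ) * walshChar k (-x)) / (b : ℂ) ^ Fintype.card I

lemma natCast_pow_ne_zero (n : ℕ) : (b : ℂ) ^ n ≠ 0 :=
  pow_ne_zero _ (Nat.cast_ne_zero.2 (Fact.out : b.Prime).ne_zero)

lemma walsh_inversion (f : (I → ZMod b) → ℝ) (y : I → ZMod b) :
    (f y : ℂ) = ∑ k, walshCoeff f k * walshChar k y := by
  have h : ∀ x, ∑ k : I → ZMod b, walshChar k (-x) * walshChar k y =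
      if x = y then (b : ℂ) ^ Fintype.card I else 0 := by
    intro x
    simp_rw [← AddChar.map_add_eq_mul, walshChar_comm _ (-x + y), sum_walshChar,
      neg_add_eq_zero]
  simp_rw [walshCoeff, div_mul_eq_mul_div, ← Finset.sum_div, Finset.sum_mul, mul_assoc]
  rw [Finset.sum_comm]
  simp_rw [← Finset.mul_sum, h]
  simp

lemma walshCoeff_zero (f : (I → ZMod b) → ℝ) :
    walshCoeff f 0 = (((∑ x, f x) / (b : ℝ) ^ Fintype.card I : ℝ) : ℂ) := by
  simp [walshCoeff, walshChar_apply]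

lemma norm_walshCoeff_le {f : (I → ZMod b) → ℝ} {B : ℝ} (hf : ∀ x, |f x| ≤ B)
    (k : I → ZMod b) : ‖walshCoeff f k‖ ≤ B := by
  have hb : (0 : ℝ) < (b : ℝ) ^ Fintype.card I :=
    pow_pos (Nat.cast_pos.2 (Fact.out : b.Prime).pos) _
  rw [walshCoeff, norm_div, norm_pow, Complex.norm_natCast, div_le_iff₀ hb]
  refine (norm_sum_le _ _).trans ?_
  refine (Finset.sum_le_sum (g := fun _ => B) fun x _ => ?_).trans ?_
  · simpa [AddChar.norm_apply] using hf x
  · simp [ZMod.card, mul_comm]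

lemma walshCoeff_sub (f g : (I → ZMod b) → ℝ) (k : I → ZMod b) :
    walshCoeff (fun x => f x - g x) k = walshCoeff f k - walshCoeff g k := by
  simp [walshCoeff, sub_mul, Finset.sum_sub_distrib, sub_div]

/-- A function that does not depend on the `i`-th digit has no Walsh coefficient at the indices
whose `i`-th digit is nonzero. -/
lemma walshCoeff_eq_zero {f : (I → ZMod b) → ℝ} {i : I}
    (hf : ∀ x, f (x + Pi.single i 1) = f x) {k : I → ZMod b} (hk : k i ≠ 0) :
    walshCoeff f k = 0 := by
  have h : (∑ x, (f x : ℂ) * walshChar k (-x)) * ZMod.stdAddChar (k i) =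
      ∑ x, (f x : ℂ) * walshChar k (-x) := by
    rw [Finset.sum_mul, ← Equiv.sum_comp (Equiv.addRight (Pi.single i 1))]
    refine Finset.sum_congr rfl fun x _ => ?_
    rw [Equiv.coe_addRight, hf, mul_assoc, ← walshChar_single, ← AddChar.map_add_eq_mul]
    rw [neg_add, neg_add_cancel_right]
  have h0 : ∑ x, (f x : ℂ) * walshChar k (-x) = 0 := by
    by_contra h0
    exact stdAddChar_ne_one hk (mul_left_cancel₀ h0 (h.trans (mul_one _).symm))
  rw [walshCoeff, h0, zero_div]

lemma sum_walshChar_mulVec (M : Matrix I J (ZMod b)) (k : I → ZMod b) :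
    ∑ t, walshChar k (M *ᵥ t) = if k ᵥ* M = 0 then (b : ℂ) ^ Fintype.card J else 0 := by
  rw [← sum_walshChar]
  simp_rw [walshChar_apply, dotProduct_mulVec]

/-- The error of the quadrature rule given by a digital net is bounded by the sum of the Walsh
coefficients over the nonzero elements of the dual net. -/
lemma digital_net_error_le (f : (I → ZMod b) → ℝ) (M : Matrix I J (ZMod b)) :
    |(∑ t, f (M *ᵥ t)) / (b : ℝ) ^ Fintype.card J - (∑ x, f x) / (b : ℝ) ^ Fintype.card I| ≤
      ∑ k with k ᵥ* M = 0 ∧ k ≠ 0, ‖walshCoeff f k‖ := by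
  have h : (((∑ t, f (M *ᵥ t)) / (b : ℝ) ^ Fintype.card J : ℝ) : ℂ) =
      ∑ k with k ᵥ* M = 0, walshCoeff f k := by
    push_cast
    simp_rw [walsh_inversion f (M *ᵥ _)]
    rw [Finset.sum_comm]
    simp_rw [← Finset.mul_sum, sum_walshChar_mulVec, mul_ite, mul_zero, Finset.sum_div,
      ite_div, zero_div, mul_div_cancel_right₀ _ (natCast_pow_ne_zero _), Finset.sum_filter]
  have h' : (((∑ t, f (M *ᵥ t)) / (b : ℝ) ^ Fintype.card J -
      (∑ x, f x) / (b : ℝ) ^ Fintype.card I : ℝ) : ℂ) =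
      ∑ k with k ᵥ* M = 0 ∧ k ≠ 0, walshCoeff f k := by
    rw [Complex.ofReal_sub, h, ← walshCoeff_zero, sub_eq_iff_eq_add]
    rw [← Finset.filter_filter, Finset.filter_ne', Finset.sum_erase_add _ _ (by simp)]
  rw [← Real.norm_eq_abs, ← Complex.norm_real, h']
  exact norm_sum_le _ _

lemma card_vecMul_eq_zero {k : I → ZMod b} (hk : k ≠ 0) :
    (Finset.univ.filter fun M : Matrix I J (ZMod b) => k ᵥ* M = 0).card * b ^ Fintype.card J =
      Fintype.card (Matrix I J (ZMod b)) := by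
  obtain ⟨i, hi⟩ := Function.ne_iff.1 hk
  let φ : Matrix I J (ZMod b) →+ (J → ZMod b) :=
    { toFun := fun M => k ᵥ* M
      map_zero' := vecMul_zero k
      map_add' := fun M M' => vecMul_add M M' k }
  have hφ : Function.Surjective φ := fun v => by
    refine ⟨vecMulVec (Pi.single i (k i)⁻¹) v, ?_⟩
    change k ᵥ* _ = v
    rw [vecMul_vecMulVec, dotProduct_single, mul_inv_cancel₀ hi, one_smul]
  have h := AddSubgroup.card_mul_index φ.ker
  rw [AddSubgroup.index_ker, AddMonoidHom.range_eq_top.2 hφ] at h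
  simp only [AddSubgroup.card_top, Nat.card_eq_fintype_card, Fintype.card_fun, ZMod.card] at h
  rw [← h, Fintype.card_subtype]
  congr 2
  ext M
  simp [φ, AddMonoidHom.mem_ker]

end Walsh

lemma Real.rpow_sum_le_sum_rpow {ι : Type*} (S : Finset ι) {f : ι → ℝ} (hf : ∀ i ∈ S, 0 ≤ f i)
    {p : ℝ} (hp0 : 0 < p) (hp1 : p ≤ 1) : (∑ i ∈ S, f i) ^ p ≤ ∑ i ∈ S, f i ^ p := by
  classical
  induction S using Finset.induction_on with
  | empty => simp [Real.zero_rpow hp0.ne']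
  | insert a S ha ih =>
    rw [Finset.sum_insert ha, Finset.sum_insert ha]
    have h1 := hf a (Finset.mem_insert_self _ _)
    have h2 := fun i hi => hf i (Finset.mem_insert_of_mem hi)
    refine (Real.rpow_add_le_add_rpow h1 (Finset.sum_nonneg h2) hp0.le hp1).trans ?_
    gcongr
    exact ih h2

section Existence

open Matrix

variable {I J : Type*} [Fintype I] [DecidableEq I] [Fintype J] [DecidableEq J]
  {b : ℕ} [Fact b.Prime]

lemma exists_matrix_dual_sum_rpow_le {p : ℝ} (hp0 : 0 < p) (hp1 : p ≤ 1)
    {W : (I → ZMod b) → ℝ} (hW : ∀ k, 0 ≤ W k) :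
    ∃ M : Matrix I J (ZMod b), (∑ k with k ᵥ* M = 0 ∧ k ≠ 0, W k) ^ p ≤
      (∑ k, W k ^ p) / (b : ℝ) ^ Fintype.card J := by
  have hb : (0 : ℝ) < (b : ℝ) ^ Fintype.card J :=
    pow_pos (Nat.cast_pos.2 (Fact.out : b.Prime).pos) _
  have key : ∑ M : Matrix I J (ZMod b), (∑ k with k ᵥ* M = 0 ∧ k ≠ 0, W k) ^ p ≤
      ∑ _M : Matrix I J (ZMod b), (∑ k, W k ^ p) / (b : ℝ) ^ Fintype.card J := by
    calc ∑ M : Matrix I J (ZMod b), (∑ k with k ᵥ* M = 0 ∧ k ≠ 0, W k) ^ p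
        ≤ ∑ M : Matrix I J (ZMod b), ∑ k with k ᵥ* M = 0 ∧ k ≠ 0, W k ^ p :=
          Finset.sum_le_sum fun M _ =>
            Real.rpow_sum_le_sum_rpow _ (fun k _ => hW k) hp0 hp1
      _ = ∑ k with k ≠ 0, ∑ M : Matrix I J (ZMod b) with k ᵥ* M = 0, W k ^ p := by
          simp_rw [← Finset.filter_filter]
          simp_rw [Finset.sum_filter]
          rw [Finset.sum_comm]
          refine Finset.sum_congr rfl fun k _ => ?_
          by_cases hk : k = 0 <;> simp [hk]
      _ = ∑ k with k ≠ 0,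
            (Fintype.card (Matrix I J (ZMod b)) : ℝ) / (b : ℝ) ^ Fintype.card J * W k ^ p := by
          refine Finset.sum_congr rfl fun k hk => ?_
          rw [Finset.sum_const, nsmul_eq_mul,
            ← card_vecMul_eq_zero (J := J) (Finset.mem_filter.1 hk).2]
          push_cast
          rw [mul_div_cancel_right₀ _ hb.ne']
      _ ≤ ∑ k, (Fintype.card (Matrix I J (ZMod b)) : ℝ) / (b : ℝ) ^ Fintype.card J * W k ^ p :=
          Finset.sum_le_sum_of_subset_of_nonneg (Finset.filter_subset _ _) fun k _ _ =>
            mul_nonneg (by positivity) (Real.rpow_nonneg (hW k) p)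
      _ = _ := by
          rw [← Finset.mul_sum, Finset.sum_const, Finset.card_univ, nsmul_eq_mul]
          ring
  obtain ⟨M, -, hM⟩ := Finset.exists_le_of_sum_le Finset.univ_nonempty key
  exact ⟨M, hM⟩

/-- There is a digital net whose error over all functions with Walsh coefficients bounded by `W`
has the order of convergence given by the summability exponent of `W`. -/
lemma exists_digital_net {p : ℝ} (hp0 : 0 < p) (hp1 : p ≤ 1)
    {W : (I → ZMod b) → ℝ} (hW : ∀ k, 0 ≤ W k) :
    ∃ M : Matrix I J (ZMod b), ∀ (c : ℝ) (f : (I → ZMod b) → ℝ),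
      (∀ k, ‖walshCoeff f k‖ ≤ c * W k) → 0 ≤ c →
      |(∑ t, f (M *ᵥ t)) / (b : ℝ) ^ Fintype.card J - (∑ x, f x) / (b : ℝ) ^ Fintype.card I| ≤
        c * ((∑ k, W k ^ p) / (b : ℝ) ^ Fintype.card J) ^ (1 / p) := by
  obtain ⟨M, hM⟩ := exists_matrix_dual_sum_rpow_le (J := J) hp0 hp1 hW
  refine ⟨M, fun c f hf hc => (digital_net_error_le f M).trans ?_⟩
  refine (Finset.sum_le_sum fun k _ => hf k).trans ?_
  rw [← Finset.mul_sum]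
  have h0 : 0 ≤ ∑ k with k ᵥ* M = 0 ∧ k ≠ 0, W k := Finset.sum_nonneg fun k _ => hW k
  refine mul_le_mul_of_nonneg_left ?_ hc
  rw [one_div, Real.le_rpow_inv_iff_of_pos h0 ((Real.rpow_nonneg h0 p).trans hM) hp0]
  exact hM

end Existence

section Differences

variable {I : Type*} [DecidableEq I]

/-- Iterated differences `g u - g (u with i-th entry 0)` over the indices in a list. -/
def iterDiff : List I → ((I → ℝ) → ℝ) → (I → ℝ) → ℝ
  | [], g => g
  | i :: l, g => fun u => iterDiff l g u - iterDiff l g (Function.update u i 0)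

lemma hasDerivAt_iterDiff {g g' : (I → ℝ) → ℝ} {i : I}
    (h : ∀ u t, HasDerivAt (fun t => g (Function.update u i t)) (g' (Function.update u i t)) t)
    {l : List I} (hi : i ∉ l) (u : I → ℝ) (t : ℝ) :
    HasDerivAt (fun t => iterDiff l g (Function.update u i t))
      (iterDiff l g' (Function.update u i t)) t := by
  induction l generalizing u with
  | nil => exact h u t
  | cons a l ih =>
    rw [List.mem_cons, not_or] at hi
    have h2 := ih hi.2 (Function.update u a 0)
    simp_rw [Function.update_comm (Ne.symm hi.1)] at h2
    exact (ih hi.2 u).sub h2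

lemma abs_sub_update_le {g g' : (I → ℝ) → ℝ} {i : I}
    (h : ∀ u t, HasDerivAt (fun t => g (Function.update u i t)) (g' (Function.update u i t)) t)
    {u : I → ℝ} {S : Set ℝ} (hS : Convex ℝ S) {B : ℝ}
    (hB : ∀ t ∈ S, |g' (Function.update u i t)| ≤ B) {t t' : ℝ} (ht : t ∈ S) (ht' : t' ∈ S) :
    |g (Function.update u i t) - g (Function.update u i t')| ≤ B * |t - t'| :=
  hS.norm_image_sub_le_of_norm_hasDerivWithin_le (f := fun t => g (Function.update u i t))
    (fun t _ => (h u t).hasDerivWithinAt) hB ht' ht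

lemma abs_iterDiff_le {ι : Type*} [DecidableEq ι] {α : ℕ} {j : I → ι} {h : I → ℝ}
    {G : (ι → ℕ) → (I → ℝ) → ℝ} {K : (ι → ℕ) → ℝ}
    (hG : ∀ ν i, (∀ a, ν a ≤ α) → ν (j i) < α → ∀ u t,
      HasDerivAt (fun t => G ν (Function.update u i t))
        (G (ν + Pi.single (j i) 1) (Function.update u i t)) t)
    (hK : ∀ ν, (∀ a, ν a ≤ α) → ∀ u, (∀ i, u i ∈ Set.Icc 0 (h i)) → |G ν u| ≤ K ν)
    {l : List I} (hl : l.Nodup) (ν : ι → ℕ)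
    (hν : ∀ a, (ν + (l.map fun i => Pi.single (j i) 1).sum : ι → ℕ) a ≤ α)
    {u : I → ℝ} (hu : ∀ i, u i ∈ Set.Icc 0 (h i)) :
    |iterDiff l (G ν) u| ≤
      (l.map h).prod * K (ν + (l.map fun i => Pi.single (j i) 1).sum) := by
  induction l generalizing ν u with
  | nil => simpa [iterDiff] using hK ν (by simpa using hν) u hu
  | cons i l ih =>
    rw [List.nodup_cons] at hl
    simp only [List.map_cons, List.sum_cons, List.prod_cons, ← add_assoc] at hν ⊢
    have hν' : ∀ a, (ν + Pi.single (j i) 1 : ι → ℕ) a ≤ α := fun a =>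
      (Nat.le_add_right _ _).trans (hν a)
    have hd := hasDerivAt_iterDiff
      (hG ν i (fun a => (Nat.le_add_right _ _).trans (hν' a)) (by simpa using hν' (j i))) hl.1
    have hmem : ∀ t ∈ Set.Icc 0 (h i), ∀ i', Function.update u i t i' ∈ Set.Icc 0 (h i') := by
      intro t ht i'
      rcases eq_or_ne i' i with rfl | hne
      · simpa using ht
      · simpa [Function.update_of_ne hne] using hu i'
    have h0 : 0 ≤ h i := (hu i).1.trans (hu i).2
    have hB := fun t ht => ih hl.2 (ν + Pi.single (j i) 1) hν (hmem t ht)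
    have hmv := abs_sub_update_le hd (convex_Icc 0 (h i)) hB (hu i) (Set.left_mem_Icc.2 h0)
    rw [Function.update_eq_self] at hmv
    refine hmv.trans ?_
    rw [sub_zero, abs_of_nonneg (hu i).1, mul_comm (h i), mul_assoc,
      mul_assoc, mul_comm (h i), ← mul_assoc, ← mul_assoc]
    exact mul_le_mul_of_nonneg_left (hu i).2 ((abs_nonneg _).trans (hB 0 (Set.left_mem_Icc.2 h0)))

variable [Fintype I] {b : ℕ} [Fact b.Prime]

/-- The vector of scaled digits of `x`. -/
def scaledDigits (w : I → ℝ) (x : I → ZMod b) : I → ℝ := fun i => (x i).val * w i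

omit [Fintype I] in
lemma scaledDigits_update_zero (w : I → ℝ) (x : I → ZMod b) (i : I) :
    Function.update (scaledDigits w x) i 0 = scaledDigits w (Function.update x i 0) := by
  ext i'
  rcases eq_or_ne i' i with rfl | hne <;> simp [scaledDigits, *]

omit [Fintype I] [DecidableEq I] in
lemma scaledDigits_mem_Icc {w : I → ℝ} (hw : ∀ i, 0 ≤ w i) (x : I → ZMod b) (i : I) :
    scaledDigits w x i ∈ Set.Icc 0 (((b : ℝ) - 1) * w i) := by
  refine ⟨mul_nonneg (Nat.cast_nonneg _) (hw i), mul_le_mul_of_nonneg_right ?_ (hw i)⟩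
  rw [le_sub_iff_add_le]
  exact_mod_cast ZMod.val_lt (x i)

lemma walshCoeff_iterDiff (w : I → ℝ) (g : (I → ℝ) → ℝ) (k : I → ZMod b) {l : List I}
    (hl : ∀ i ∈ l, k i ≠ 0) :
    walshCoeff (fun x => iterDiff l g (scaledDigits w x)) k =
      walshCoeff (fun x => g (scaledDigits w x)) k := by
  induction l with
  | nil => rfl
  | cons i l ih =>
    simp only [iterDiff]
    rw [walshCoeff_sub, ih fun i' hi' => hl i' (List.mem_cons_of_mem _ hi'), sub_eq_self]
    refine walshCoeff_eq_zero (i := i) (fun x => ?_) (hl i List.mem_cons_self)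
    simp_rw [scaledDigits_update_zero]
    congr 2
    ext i'
    rcases eq_or_ne i' i with rfl | hne <;> simp [*]

end Differences

section Gather

variable {I ι : Type*} [Fintype I] [DecidableEq I] [DecidableEq ι]

/-- The vector whose `a`-th entry is the sum of the `u i` with `j i = a`. -/
def fiberSum (j : I → ι) (u : I → ℝ) : ι → ℝ := ∑ i, u i • Pi.single (j i) 1

omit [DecidableEq I] in
lemma fiberSum_apply (j : I → ι) (u : I → ℝ) (a : ι) :
    fiberSum j u a = ∑ i, if j i = a then u i else 0 := by
  simp [fiberSum, Finset.sum_apply, Pi.single_apply, eq_comm]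

lemma fiberSum_update (j : I → ι) (u : I → ℝ) (i : I) (t t' : ℝ) :
    fiberSum j (Function.update u i t) =
      fiberSum j (Function.update u i t') + (t - t') • Pi.single (j i) 1 := by
  rw [← sub_eq_iff_eq_add', fiberSum, fiberSum, ← Finset.sum_sub_distrib,
    Finset.sum_eq_single i]
  · simp [sub_smul]
  · intro i' _ hne
    simp [Function.update_of_ne hne]
  · simp

lemma HasLineDerivAt.hasDerivAt_fiberSum_update [Fintype ι] {f f' : (ι → ℝ) → ℝ} {j : I → ι}
    {i : I}
    (h : ∀ x, HasLineDerivAt ℝ f (f' x) x (Pi.single (j i) 1)) (u : I → ℝ) (t : ℝ) :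
    HasDerivAt (fun t => f (fiberSum j (Function.update u i t)))
      (f' (fiberSum j (Function.update u i t))) t := by
  have h1 := h (fiberSum j (Function.update u i t))
  rw [HasLineDerivAt, ← sub_self t] at h1
  have h2 := h1.comp_sub_const (x := t) (a := t)
  simpa only [← fiberSum_update] using h2

lemma HasLineDerivAt.hasDerivAt_update [Fintype ι] {f f' : (ι → ℝ) → ℝ} {i : ι}
    (h : ∀ x, HasLineDerivAt ℝ f (f' x) x (Pi.single i 1)) (u : ι → ℝ) (t : ℝ) :
    HasDerivAt (fun t => f (Function.update u i t)) (f' (Function.update u i t)) t := by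
  have hid : ∀ v : ι → ℝ, fiberSum id v = v := fun v => by
    ext a
    simp [fiberSum_apply]
  simpa only [hid] using HasLineDerivAt.hasDerivAt_fiberSum_update (j := id) h u t

/-- A function on the unit cube with bounded partial derivatives is Lipschitz. -/
lemma abs_sub_le_of_partial_bound [Fintype ι] {f : (ι → ℝ) → ℝ} {f' : ι → (ι → ℝ) → ℝ}
    {B : ι → ℝ} (h : ∀ i x, HasLineDerivAt ℝ f (f' i x) x (Pi.single i 1))
    (hB : ∀ i x, (∀ a, x a ∈ Set.Icc (0 : ℝ) 1) → |f' i x| ≤ B i) {x y : ι → ℝ}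
    (hx : ∀ a, x a ∈ Set.Icc (0 : ℝ) 1) (hy : ∀ a, y a ∈ Set.Icc (0 : ℝ) 1) :
    |f x - f y| ≤ ∑ i, B i * |x i - y i| := by
  suffices H : ∀ S : Finset ι, |f (S.piecewise x y) - f y| ≤ ∑ i ∈ S, B i * |x i - y i| by
    simpa using H Finset.univ
  intro S
  induction S using Finset.induction_on with
  | empty => simp
  | insert i S hi ih =>
    rw [Finset.sum_insert hi, Finset.piecewise_insert]
    have hmem : ∀ t ∈ Set.Icc (0 : ℝ) 1, ∀ a,
        Function.update (S.piecewise x y) i t a ∈ Set.Icc (0 : ℝ) 1 := by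
      intro t ht a
      rcases eq_or_ne a i with rfl | hne
      · simpa using ht
      · rw [Function.update_of_ne hne]
        by_cases ha : a ∈ S
        · simpa [ha] using hx a
        · simpa [ha] using hy a
    have hmv := abs_sub_update_le (HasLineDerivAt.hasDerivAt_update (h i)) (convex_Icc 0 1)
      (fun t ht => hB i _ (hmem t ht)) (hx i) (hy i)
    rw [show Function.update (S.piecewise x y) i (y i) = S.piecewise x y by
      rw [Function.update_eq_iff]; simp [hi]] at hmv
    exact (abs_sub_le _ (f (S.piecewise x y)) _).trans (add_le_add hmv ih)

end Gather

section Grid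

variable {ι : Type*} [Fintype ι] [DecidableEq ι]

omit [Fintype ι] [DecidableEq ι] in
lemma iUnion_grid_boxes {M : ℕ} (hM : 0 < M) :
    ⋃ g : ι → Fin M, (Set.univ.pi fun i => Set.Ico ((g i : ℝ) / M) (((g i : ℝ) + 1) / M)) =
      Set.univ.pi fun _ : ι => Set.Ico (0 : ℝ) 1 := by
  have hM' : (0 : ℝ) < M := Nat.cast_pos.2 hM
  ext x
  simp only [Set.mem_iUnion, Set.mem_univ_pi, Set.mem_Ico, div_le_iff₀ hM', lt_div_iff₀ hM']
  constructor
  · rintro ⟨g, hg⟩ i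
    have h1 : ((g i : ℕ) : ℝ) + 1 ≤ M := by exact_mod_cast (g i).2
    have h2 := hg i
    have h3 : (0 : ℝ) ≤ (g i : ℕ) := Nat.cast_nonneg _
    constructor
    · exact nonneg_of_mul_nonneg_left (h3.trans h2.1) hM'
    · by_contra! h
      nlinarith
  · intro hx
    refine ⟨fun i => ⟨⌊x i * M⌋₊, ?_⟩, fun i => ⟨?_, ?_⟩⟩
    · rw [Nat.floor_lt (mul_nonneg (hx i).1 hM'.le)]
      nlinarith [hx i]
    · exact Nat.floor_le (mul_nonneg (hx i).1 hM'.le)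
    · exact Nat.lt_floor_add_one _

omit [Fintype ι] [DecidableEq ι] in
lemma pairwise_disjoint_grid_boxes {M : ℕ} (hM : 0 < M) :
    Pairwise (Function.onFun Disjoint fun g : ι → Fin M =>
      Set.univ.pi fun i => Set.Ico ((g i : ℝ) / M) (((g i : ℝ) + 1) / M)) := by
  have hM' : (0 : ℝ) < M := Nat.cast_pos.2 hM
  intro g g' hne
  obtain ⟨i, hi⟩ := Function.ne_iff.1 hne
  refine Set.disjoint_left.2 fun x hx hx' => hi (Fin.ext ?_)
  have h1 := hx i trivial
  have h2 := hx' i trivial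
  simp only [Set.mem_Ico, div_le_iff₀ hM', lt_div_iff₀ hM'] at h1 h2
  have h3 : ((g i : ℕ) : ℝ) < (g' i : ℕ) + 1 := h1.1.trans_lt h2.2
  have h4 : ((g' i : ℕ) : ℝ) < (g i : ℕ) + 1 := h2.1.trans_lt h1.2
  norm_cast at h3 h4
  omega

lemma grid_average_error_le {M : ℕ} (hM : 0 < M) {F : (ι → ℝ) → ℝ} (hF : Continuous F) {E : ℝ}
    (hE : ∀ x y : ι → ℝ, (∀ i, x i ∈ Set.Icc (0 : ℝ) 1) → (∀ i, y i ∈ Set.Icc (0 : ℝ) 1) →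
      (∀ i, |x i - y i| ≤ 1 / (M : ℝ)) → |F x - F y| ≤ E) :
    |(∑ g : ι → Fin M, F fun i => (g i : ℝ) / M) / (M : ℝ) ^ Fintype.card ι -
      ∫ x in Set.univ.pi fun _ : ι => Set.Icc (0 : ℝ) 1, F x| ≤ E := by
  have hM' : (0 : ℝ) < M := Nat.cast_pos.2 hM
  set box : (ι → Fin M) → Set (ι → ℝ) := fun g =>
    Set.univ.pi fun i => Set.Ico ((g i : ℝ) / M) (((g i : ℝ) + 1) / M) with hbox
  have hvol : ∀ g, volume (box g) = ENNReal.ofReal (1 / M) ^ Fintype.card ι := fun g => by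
    rw [hbox, Real.volume_pi_Ico]
    simp [← sub_div]
  have hvol' : ∀ g, volume.real (box g) = 1 / (M : ℝ) ^ Fintype.card ι := fun g => by
    rw [Measure.real, hvol, ENNReal.toReal_pow, ENNReal.toReal_ofReal (by positivity), div_pow,
      one_pow]
  have hlt : ∀ g, volume (box g) < ⊤ := fun g => by
    rw [hvol]
    exact ENNReal.pow_lt_top ENNReal.ofReal_lt_top
  have hunion : ⋃ g, box g = Set.univ.pi fun _ : ι => Set.Ico (0 : ℝ) 1 := iUnion_grid_boxes hM
  have hcube : (Set.univ.pi fun _ : ι => Set.Icc (0 : ℝ) 1) = Set.Icc 0 1 :=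
    Set.pi_univ_Icc 0 1
  have hsub : ∀ g, box g ⊆ Set.Icc 0 1 := fun g => by
    rw [← hcube]
    exact (Set.subset_iUnion box g).trans
      (hunion.le.trans (Set.pi_mono fun _ _ => Set.Ico_subset_Icc_self))
  have hFint : ∀ g, IntegrableOn F (box g) := fun g =>
    (hF.continuousOn.integrableOn_compact isCompact_Icc).mono_set (hsub g)
  have hmeas : ∀ g, MeasurableSet (box g) := fun g =>
    MeasurableSet.univ_pi fun _ => measurableSet_Ico
  have hI : ∫ x in Set.univ.pi fun _ : ι => Set.Icc (0 : ℝ) 1, F x = ∑ g, ∫ x in box g, F x := by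
    rw [← integral_iUnion_fintype hmeas (pairwise_disjoint_grid_boxes hM) hFint, hunion, hcube]
    exact setIntegral_congr_set (Measure.univ_pi_Ico_ae_eq_Icc (f := 0) (g := 1)).symm
  have hterm : ∀ g : ι → Fin M,
      |(F fun i => (g i : ℝ) / M) / (M : ℝ) ^ Fintype.card ι - ∫ x in box g, F x| ≤
        E * (1 / (M : ℝ) ^ Fintype.card ι) := by
    intro g
    have hcorner : (fun i => (g i : ℝ) / M) ∈ box g := fun i _ =>
      ⟨le_rfl, div_lt_div_of_pos_right (lt_add_one _) hM'⟩
    have h1 : (F fun i => (g i : ℝ) / M) / (M : ℝ) ^ Fintype.card ι - ∫ x in box g, F x =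
        ∫ x in box g, ((F fun i => (g i : ℝ) / M) - F x) := by
      rw [integral_sub (integrable_const_iff.2 (Or.inr ⟨by simpa using hlt g⟩)) (hFint g),
        setIntegral_const, hvol',
        smul_eq_mul, one_div_mul_eq_div]
    rw [h1, ← hvol' g]
    refine norm_setIntegral_le_of_norm_le_const (f := fun x => (F fun i => (g i : ℝ) / M) - F x)
      (hlt g) fun x hx => hE _ _ ?_ ?_ fun i => ?_
    · exact fun i => ⟨(hsub g hcorner).1 i, (hsub g hcorner).2 i⟩
    · exact fun i => ⟨(hsub g hx).1 i, (hsub g hx).2 i⟩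
    · have h2 := Set.mem_Ico.1 (hx i trivial)
      rw [add_div] at h2
      rw [abs_sub_comm, abs_of_nonneg (sub_nonneg.2 h2.1)]
      linarith [h2.2]
  rw [hI, Finset.sum_div, ← Finset.sum_sub_distrib]
  refine (Finset.abs_sum_le_sum_abs _ _).trans ((Finset.sum_le_sum fun g _ => hterm g).trans ?_)
  rw [Finset.sum_const, Finset.card_univ, Fintype.card_fun, Fintype.card_fin, nsmul_eq_mul]
  push_cast
  rw [mul_one_div, mul_div_cancel₀ _ (pow_pos hM' _).ne']

end Grid

section Digits

variable {s α n b : ℕ} [Fact b.Prime]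

/-- The weight of a digit: the `n * α` digits of each coordinate are split into `α` residue
classes of `n` digits each. -/
noncomputable def digitWeight (s α n b : ℕ) (i : (Fin s × Fin α) × Fin n) : ℝ :=
  (b : ℝ) ^ (finProdFinEquiv (i.2, i.1.2) : ℕ) / (b : ℝ) ^ (n * α)

omit [Fact b.Prime] in
lemma digitWeight_nonneg (i : (Fin s × Fin α) × Fin n) : 0 ≤ digitWeight s α n b i := by
  unfold digitWeight
  positivity

lemma fiberSum_digits (u : (Fin s × Fin α) × Fin n → ℝ) (a : Fin s) :
    fiberSum (fun i => i.1.1) u a = ∑ q : Fin (n * α),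
      u ((a, (finProdFinEquiv.symm q).2), (finProdFinEquiv.symm q).1) := by
  rw [fiberSum_apply, Fintype.sum_prod_type, Fintype.sum_prod_type, Finset.sum_eq_single a,
    ← Equiv.sum_comp finProdFinEquiv, Fintype.sum_prod_type_right]
  · simp
  · intro a' _ hne
    simp [hne]
  · simp

/-- Reading off the digits of each coordinate. -/
def digitEquiv (x : (Fin s × Fin α) × Fin n → ZMod b) (a : Fin s) : Fin (b ^ (n * α)) :=
  finFunctionFinEquiv fun q =>
    ⟨(x ((a, (finProdFinEquiv.symm q).2), (finProdFinEquiv.symm q).1)).val,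
    ZMod.val_lt _⟩

lemma digitEquiv_bijective :
    Function.Bijective (digitEquiv : ((Fin s × Fin α) × Fin n → ZMod b) → _) := by
  rw [Fintype.bijective_iff_injective_and_card]
  refine ⟨fun x y h => ?_, ?_⟩
  · ext ⟨⟨a, r⟩, ℓ⟩
    have h1 := congrFun (finFunctionFinEquiv.injective (congrFun h a)) (finProdFinEquiv (ℓ, r))
    exact ZMod.val_injective b (by simpa using congrArg Fin.val h1)
  · simp only [Fintype.card_fun, ZMod.card, Fintype.card_prod, Fintype.card_fin]
    ring

lemma fiberSum_scaledDigits (x : (Fin s × Fin α) × Fin n → ZMod b) :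
    fiberSum (fun i => i.1.1) (scaledDigits (digitWeight s α n b) x) =
      fun a => (digitEquiv x a : ℝ) / ((b ^ (n * α) : ℕ) : ℝ) := by
  ext a
  rw [fiberSum_digits, digitEquiv, finFunctionFinEquiv_apply]
  push_cast
  rw [Finset.sum_div]
  refine Finset.sum_congr rfl fun q _ => ?_
  simp only [scaledDigits, digitWeight, Prod.mk.eta, Equiv.apply_symm_apply]
  ring

lemma sum_fiberSum_scaledDigits (F : (Fin s → ℝ) → ℝ) :
    ∑ x : (Fin s × Fin α) × Fin n → ZMod b,
      F (fiberSum (fun i => i.1.1) (scaledDigits (digitWeight s α n b) x)) =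
      ∑ g : Fin s → Fin (b ^ (n * α)), F fun a => (g a : ℝ) / ((b ^ (n * α) : ℕ) : ℝ) := by
  simp_rw [fiberSum_scaledDigits]
  exact digitEquiv_bijective.sum_comp fun g : Fin s → Fin (b ^ (n * α)) =>
    F fun a => (g a : ℝ) / ((b ^ (n * α) : ℕ) : ℝ)

lemma fiberSum_mem_Icc {u : (Fin s × Fin α) × Fin n → ℝ}
    (hu : ∀ i, u i ∈ Set.Icc 0 (((b : ℝ) - 1) * digitWeight s α n b i)) (a : Fin s) :
    fiberSum (fun i => i.1.1) u a ∈ Set.Icc (0 : ℝ) 1 := by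
  have hb : (0 : ℝ) < (b : ℝ) ^ (n * α) := pow_pos (Nat.cast_pos.2 (Fact.out : b.Prime).pos) _
  rw [fiberSum_digits]
  refine ⟨Finset.sum_nonneg fun q _ => (hu _).1,
    (Finset.sum_le_sum fun q _ => (hu _).2).trans ?_⟩
  simp only [digitWeight, Prod.mk.eta, Equiv.apply_symm_apply]
  rw [← Finset.mul_sum, ← Finset.sum_div, Fin.sum_univ_eq_sum_range (fun q => (b : ℝ) ^ q),
    ← mul_div_assoc, mul_geom_sum, div_le_one hb]
  linarith

end Digits

section LeadingDigit

variable {n b : ℕ} [NeZero n]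

/-- The first index of a nonzero digit. -/
noncomputable def leadIndex (κ : Fin n → ZMod b) : Fin n :=
  open Classical in
  if h : (Finset.univ.filter fun ℓ => κ ℓ ≠ 0).Nonempty then Finset.min' _ h else 0

lemma leadIndex_spec {κ : Fin n → ZMod b} (hκ : κ ≠ 0) :
    κ (leadIndex κ) ≠ 0 ∧ ∀ ℓ < leadIndex κ, κ ℓ = 0 := by
  classical
  obtain ⟨ℓ, hℓ⟩ := Function.ne_iff.1 hκ
  have h : (Finset.univ.filter fun ℓ => κ ℓ ≠ 0).Nonempty := ⟨ℓ, by simpa using hℓ⟩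
  have hdef : leadIndex κ = Finset.min' _ h := by
    rw [leadIndex]
    convert dif_pos h
  rw [hdef]
  refine ⟨(Finset.mem_filter.1 (Finset.min'_mem _ h)).2, fun ℓ' hlt => ?_⟩
  by_contra hne
  exact (Finset.min'_le _ ℓ' (by simpa using hne)).not_gt hlt

variable [Fact b.Prime]

lemma card_leadIndex_le (ℓ : Fin n) :
    (Finset.univ.filter fun κ : Fin n → ZMod b => κ ≠ 0 ∧ leadIndex κ = ℓ).card ≤
      b ^ (n - ℓ) := by
  classical
  let t : Fin n → Finset (ZMod b) := fun ℓ' => if ℓ' < ℓ then {0} else Finset.univ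
  have hsub : (Finset.univ.filter fun κ : Fin n → ZMod b => κ ≠ 0 ∧ leadIndex κ = ℓ) ⊆
      Fintype.piFinset t := by
    intro κ hκ
    obtain ⟨hκ0, rfl⟩ := (Finset.mem_filter.1 hκ).2
    refine Fintype.mem_piFinset.2 fun ℓ' => ?_
    by_cases h : ℓ' < leadIndex κ
    · simp [t, h, (leadIndex_spec hκ0).2 ℓ' h]
    · simp [t, h]
  refine (Finset.card_le_card hsub).trans ?_
  rw [Fintype.card_piFinset]
  have ht : ∀ ℓ', (t ℓ').card = if ℓ ≤ ℓ' then b else 1 := fun ℓ' => by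
    by_cases h : ℓ' < ℓ
    · simp [t, h]
    · simp [t, h, not_lt.1 h, ZMod.card]
  simp_rw [ht]
  rw [← Finset.prod_filter, Finset.prod_const, Finset.filter_le_eq_Ici, Fin.card_Ici]

lemma sum_leadIndex_le {v : Fin n → ℝ} (hv : ∀ ℓ, 0 ≤ v ℓ) :
    ∑ κ : Fin n → ZMod b with κ ≠ 0, v (leadIndex κ) ≤
      ∑ ℓ : Fin n, (b : ℝ) ^ (n - ℓ : ℕ) * v ℓ := by
  rw [← Finset.sum_fiberwise (g := leadIndex)]
  refine Finset.sum_le_sum fun ℓ _ => ?_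
  rw [Finset.filter_filter, Finset.sum_congr rfl (g := fun _ => v ℓ) fun κ hκ => by
    rw [(Finset.mem_filter.1 hκ).2.2], Finset.sum_const, nsmul_eq_mul]
  exact mul_le_mul_of_nonneg_right (by exact_mod_cast card_leadIndex_le ℓ) (hv ℓ)

/-- The one-dimensional bound for the Walsh coefficients of order `α`. -/
noncomputable def leadWeight (α : ℕ) (B : ℝ) (κ : Fin n → ZMod b) : ℝ :=
  open Classical in if κ = 0 then 1 else B * ((b : ℝ) ^ α)⁻¹ ^ (n - 1 - leadIndex κ : ℕ)

lemma leadWeight_nonneg (α : ℕ) {B : ℝ} (hB : 0 ≤ B) (κ : Fin n → ZMod b) :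
    0 ≤ leadWeight α B κ := by
  unfold leadWeight
  split_ifs <;> positivity

lemma sum_leadWeight_rpow_le {α : ℕ} {p : ℝ} (hp : 1 < p * α) {B : ℝ} (hB : 0 ≤ B) :
    ∑ κ : Fin n → ZMod b, leadWeight α B κ ^ p ≤
      1 + B ^ p * (b * (1 - (b : ℝ) ^ (1 - p * α))⁻¹) := by
  classical
  have hb : (1 : ℝ) < b := Nat.one_lt_cast.2 (Fact.out : b.Prime).one_lt
  have hb0 : (0 : ℝ) < b := zero_lt_one.trans hb
  set Q : ℝ := (b : ℝ) ^ (-(p * α)) with hQ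
  have hQ0 : 0 ≤ Q := Real.rpow_nonneg hb0.le _
  have hbQ : (b : ℝ) * Q = (b : ℝ) ^ (1 - p * α) := by
    rw [hQ, sub_eq_add_neg, Real.rpow_add hb0, Real.rpow_one]
  have hbQ0 : 0 ≤ (b : ℝ) * Q := by positivity
  have hbQ1 : (b : ℝ) * Q < 1 := by
    rw [hbQ]
    exact Real.rpow_lt_one_of_one_lt_of_neg hb (by linarith)
  have hterm : ∀ κ : Fin n → ZMod b, κ ≠ 0 →
      leadWeight α B κ ^ p = B ^ p * Q ^ (n - 1 - leadIndex κ : ℕ) := by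
    intro κ hκ
    rw [leadWeight, if_neg hκ, Real.mul_rpow hB (by positivity), ← Real.rpow_natCast (_)⁻¹,
      ← Real.rpow_mul (by positivity), mul_comm _ p, Real.rpow_mul (by positivity),
      Real.rpow_natCast, hQ, Real.inv_rpow (by positivity), ← Real.rpow_natCast _ α,
      ← Real.rpow_mul hb0.le, mul_comm _ p, Real.rpow_neg hb0.le]
  rw [← Finset.add_sum_erase _ _ (Finset.mem_univ (0 : Fin n → ZMod b)), ← Finset.filter_ne']
  refine add_le_add (by simp [leadWeight]) ?_
  rw [Finset.sum_congr rfl fun κ hκ => hterm κ (Finset.mem_filter.1 hκ).2, ← Finset.mul_sum]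
  refine mul_le_mul_of_nonneg_left ?_ (Real.rpow_nonneg hB p)
  refine (sum_leadIndex_le (v := fun ℓ => Q ^ (n - 1 - ℓ : ℕ)) fun ℓ => pow_nonneg hQ0 _).trans ?_
  have hsplit : ∀ ℓ : Fin n, (b : ℝ) ^ (n - ℓ : ℕ) * Q ^ (n - 1 - ℓ : ℕ) =
      b * (b * Q) ^ (n - 1 - ℓ : ℕ) := fun ℓ => by
    rw [show (n - ℓ : ℕ) = (n - 1 - ℓ : ℕ) + 1 by have := ℓ.2; omega, mul_pow]
    ring
  simp_rw [hsplit]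
  rw [← Finset.mul_sum, Fin.sum_univ_eq_sum_range (fun ℓ => ((b : ℝ) * Q) ^ (n - 1 - ℓ)),
    Finset.sum_range_reflect, ← hbQ]
  refine mul_le_mul_of_nonneg_left ?_ hb0.le
  rw [← tsum_geometric_of_lt_one hbQ0 hbQ1]
  exact (summable_geometric_of_lt_one hbQ0 hbQ1).sum_le_tsum _ fun i _ => pow_nonneg hbQ0 i

end LeadingDigit

section WalshBound

variable {s α n b : ℕ} [Fact b.Prime]

lemma mul_digitWeight_le (i : (Fin s × Fin α) × Fin n) :
    ((b : ℝ) - 1) * digitWeight s α n b i ≤ ((b : ℝ) ^ α)⁻¹ ^ (n - 1 - i.2 : ℕ) := by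
  have hb : (1 : ℝ) ≤ b := Nat.one_le_cast.2 (Fact.out : b.Prime).one_lt.le
  have hb0 : (0 : ℝ) < b := zero_lt_one.trans_le hb
  have hexp : (finProdFinEquiv (i.2, i.1.2) : ℕ) + 1 ≤ α * (i.2 + 1) := by
    have := i.1.2.2
    simp only [finProdFinEquiv_apply_val]
    nlinarith
  have hn : n * α = α * (i.2 + 1) + α * (n - 1 - i.2) := by
    rw [← mul_add, mul_comm n]
    congr 1
    have := i.2.2
    omega
  rw [digitWeight]
  generalize (finProdFinEquiv (i.2, i.1.2) : ℕ) = q at hexp ⊢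
  rw [inv_pow, ← pow_mul, hn, pow_add, ← mul_div_assoc, inv_eq_one_div,
    div_le_div_iff₀ (by positivity) (by positivity), one_mul]
  refine mul_le_mul_of_nonneg_right ?_ (by positivity)
  calc ((b : ℝ) - 1) * b ^ q
      ≤ b * b ^ q := by gcongr; linarith
    _ = (b : ℝ) ^ (q + 1) := (pow_succ' _ _).symm
    _ ≤ _ := pow_le_pow_right₀ hb hexp

lemma prod_factorial_mul_prod_pow_le {ι : Type*} [Fintype ι] {β : ι → ℝ} (hβ : ∀ a, 0 ≤ β a)
    {ν : ι → ℕ} (hν : ∀ a, ν a ≤ α) :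
    (∏ a, ((ν a).factorial : ℝ)) * ∏ a, β a ^ ν a ≤ ∏ a, (α * β a) ^ ν a := by
  rw [← Finset.prod_mul_distrib]
  refine Finset.prod_le_prod (fun a _ => mul_nonneg (Nat.cast_nonneg _) (pow_nonneg (hβ a) _))
    fun a _ => ?_
  rw [mul_pow]
  refine mul_le_mul_of_nonneg_right ?_ (pow_nonneg (hβ a) _)
  exact_mod_cast (Nat.factorial_le_pow (ν a)).trans (Nat.pow_le_pow_left (hν a) _)

lemma prod_pow_sum_single {ι κ : Type*} [Fintype ι] [DecidableEq ι] (x : ι → ℝ) (T : Finset κ)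
    (j : κ → ι) :
    ∏ a, x a ^ (∑ σ ∈ T, (Pi.single (j σ) 1 : ι → ℕ)) a = ∏ σ ∈ T, x (j σ) := by
  simp_rw [Finset.sum_apply, ← Finset.prod_pow_eq_pow_sum]
  rw [Finset.prod_comm]
  refine Finset.prod_congr rfl fun σ _ => ?_
  rw [Finset.prod_eq_single (j σ)]
  · simp
  · intro a _ hne
    simp [hne]
  · simp

/-- The Walsh coefficients of a function with mixed partial derivatives up to order `α` satisfying
a product-form bound. -/
lemma norm_walshCoeff_le_leadWeight [NeZero n] {β : Fin s → ℝ} (hβ : ∀ a, 0 ≤ β a) {c : ℝ}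
    (hc : 0 ≤ c) {Fd : (Fin s → ℕ) → (Fin s → ℝ) → ℝ}
    (hd : ∀ (ν : Fin s → ℕ) (j : Fin s), (∀ i, ν i ≤ α) → ν j < α → ∀ x,
      HasLineDerivAt ℝ (Fd ν) (Fd (ν + Pi.single j 1) x) x (Pi.single j 1))
    (hbd : ∀ ν : Fin s → ℕ, (∀ i, ν i ≤ α) → ∀ x : Fin s → ℝ, (∀ i, x i ∈ Set.Icc (0 : ℝ) 1) →
      |Fd ν x| ≤ c * (∏ i, ((ν i).factorial : ℝ)) * ∏ i, β i ^ ν i)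
    (k : (Fin s × Fin α) × Fin n → ZMod b) :
    ‖walshCoeff (fun x => Fd 0 (fiberSum (fun i => i.1.1)
        (scaledDigits (digitWeight s α n b) x))) k‖ ≤
      c * ∏ σ : Fin s × Fin α, leadWeight α (α * β σ.1) fun ℓ => k (σ, ℓ) := by
  classical
  let T : Finset (Fin s × Fin α) := Finset.univ.filter fun σ => (fun ℓ => k (σ, ℓ)) ≠ 0
  let e : Fin s × Fin α → (Fin s × Fin α) × Fin n := fun σ => (σ, leadIndex fun ℓ => k (σ, ℓ))
  let j : (Fin s × Fin α) × Fin n → Fin s := fun i => i.1.1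
  have hnodup : (T.toList.map e).Nodup :=
    T.nodup_toList.map fun σ σ' h => congrArg Prod.fst h
  have hk : ∀ i ∈ T.toList.map e, k i ≠ 0 := by
    intro i hi
    obtain ⟨σ, hσ, rfl⟩ := List.mem_map.1 hi
    exact (leadIndex_spec (Finset.mem_filter.1 (Finset.mem_toList.1 hσ)).2).1
  have hsum : ((T.toList.map e).map fun i => (Pi.single (j i) 1 : Fin s → ℕ)).sum =
      ∑ σ ∈ T, Pi.single σ.1 1 := by
    rw [List.map_map, Finset.sum_map_toList]
    rfl
  have hle : ∀ a, (∑ σ ∈ T, (Pi.single σ.1 1 : Fin s → ℕ)) a ≤ α := by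
    intro a
    rw [Finset.sum_apply]
    refine (Finset.sum_le_sum_of_subset (Finset.subset_univ T)).trans (le_of_eq ?_)
    rw [Fintype.sum_prod_type]
    simp [Pi.single_apply]
  have hdiff := fun x : (Fin s × Fin α) × Fin n → ZMod b =>
    abs_iterDiff_le (α := α) (j := j) (h := fun i => ((b : ℝ) - 1) * digitWeight s α n b i)
      (G := fun ν u => Fd ν (fiberSum j u))
      (K := fun ν => c * (∏ i, ((ν i).factorial : ℝ)) * ∏ i, β i ^ ν i)
      (fun ν i hν hνi => HasLineDerivAt.hasDerivAt_fiberSum_update (hd ν (j i) hν hνi))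
      (fun ν hν u hu => hbd ν hν _ (fiberSum_mem_Icc hu)) hnodup 0
      (by rw [zero_add, hsum]; exact hle)
      (scaledDigits_mem_Icc digitWeight_nonneg x)
  rw [zero_add, hsum] at hdiff
  rw [← walshCoeff_iterDiff _ (fun u => Fd 0 (fiberSum j u)) k hk]
  refine (norm_walshCoeff_le hdiff k).trans ?_
  rw [List.map_map, Finset.prod_map_toList, mul_assoc c, mul_left_comm]
  refine mul_le_mul_of_nonneg_left ?_ hc
  have hprod : ∏ σ : Fin s × Fin α, leadWeight α (α * β σ.1) (fun ℓ => k (σ, ℓ)) =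
      (∏ σ ∈ T, ((b : ℝ) ^ α)⁻¹ ^ (n - 1 - (e σ).2 : ℕ)) * ∏ σ ∈ T, (α * β σ.1) := by
    rw [← Finset.prod_mul_distrib, Finset.prod_filter]
    refine Finset.prod_congr rfl fun σ _ => ?_
    rw [leadWeight, ite_not, mul_comm]
  rw [hprod, ← prod_pow_sum_single (fun a => α * β a) T Prod.fst]
  have hb : (1 : ℝ) ≤ b := Nat.one_le_cast.2 (Fact.out : b.Prime).one_lt.le
  refine mul_le_mul ?_ (prod_factorial_mul_prod_pow_le hβ hle) ?_ ?_
  · exact Finset.prod_le_prod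
      (fun σ _ => mul_nonneg (sub_nonneg.2 hb) (digitWeight_nonneg _))
      fun σ _ => mul_digitWeight_le _
  · exact mul_nonneg (Finset.prod_nonneg fun _ _ => Nat.cast_nonneg _)
      (Finset.prod_nonneg fun a _ => pow_nonneg (hβ a) _)
  · positivity

lemma sum_prod_leadWeight_rpow_le [NeZero n] {p : ℝ} (hp : 1 < p * α)
    {β : Fin s → ℝ} (hβ : ∀ a, 0 ≤ β a) :
    ∑ k : (Fin s × Fin α) × Fin n → ZMod b,
        (∏ σ : Fin s × Fin α, leadWeight α (α * β σ.1) fun ℓ => k (σ, ℓ)) ^ p ≤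
      Real.exp ((α : ℝ) ^ p * (b * (1 - (b : ℝ) ^ (1 - p * α))⁻¹) * (α * ∑ a, β a ^ p)) := by
  have hαβ : ∀ a, 0 ≤ α * β a := fun a => mul_nonneg (Nat.cast_nonneg _) (hβ a)
  have hfactor : ∑ k : (Fin s × Fin α) × Fin n → ZMod b,
      (∏ σ : Fin s × Fin α, leadWeight α (α * β σ.1) fun ℓ => k (σ, ℓ)) ^ p =
      ∏ σ : Fin s × Fin α, ∑ κ : Fin n → ZMod b, leadWeight α (α * β σ.1) κ ^ p := by
    rw [Finset.prod_univ_sum, Fintype.piFinset_univ,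
      ← (Equiv.curry (Fin s × Fin α) (Fin n) (ZMod b)).sum_comp]
    refine Finset.sum_congr rfl fun k _ => ?_
    rw [← Real.finsetProd_rpow _ _ fun σ _ => leadWeight_nonneg α (hαβ σ.1) _]
    rfl
  rw [hfactor]
  calc ∏ σ : Fin s × Fin α, ∑ κ : Fin n → ZMod b, leadWeight α (α * β σ.1) κ ^ p
      ≤ ∏ σ : Fin s × Fin α,
          Real.exp ((α * β σ.1) ^ p * (b * (1 - (b : ℝ) ^ (1 - p * α))⁻¹)) := by
        refine Finset.prod_le_prod (fun σ _ => Finset.sum_nonneg fun κ _ =>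
          Real.rpow_nonneg (leadWeight_nonneg α (hαβ σ.1) κ) p) fun σ _ => ?_
        refine (sum_leadWeight_rpow_le hp (hαβ σ.1)).trans ?_
        rw [add_comm]
        exact Real.add_one_le_exp _
    _ = _ := by
        rw [← Real.exp_sum, Fintype.sum_prod_type]
        congr 1
        simp_rw [Finset.sum_const, Finset.card_univ, Fintype.card_fin, nsmul_eq_mul,
          Real.mul_rpow (Nat.cast_nonneg α) (hβ _), Finset.mul_sum]
        refine Finset.sum_congr rfl fun a _ => ?_
        ring

lemma digit_grid_error_le {β : Fin s → ℝ} {c : ℝ} {Fd : (Fin s → ℕ) → (Fin s → ℝ) → ℝ}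
    (hα : 1 ≤ α) (hcont : Continuous (Fd 0)) (hβ : ∀ a, 0 ≤ β a) (hc : 0 ≤ c)
    (hd : ∀ (ν : Fin s → ℕ) (j : Fin s), (∀ i, ν i ≤ α) → ν j < α → ∀ x,
      HasLineDerivAt ℝ (Fd ν) (Fd (ν + Pi.single j 1) x) x (Pi.single j 1))
    (hbd : ∀ ν : Fin s → ℕ, (∀ i, ν i ≤ α) → ∀ x : Fin s → ℝ, (∀ i, x i ∈ Set.Icc (0 : ℝ) 1) →
      |Fd ν x| ≤ c * (∏ i, ((ν i).factorial : ℝ)) * ∏ i, β i ^ ν i) :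
    |(∑ x : (Fin s × Fin α) × Fin n → ZMod b, Fd 0 (fiberSum (fun i => i.1.1)
        (scaledDigits (digitWeight s α n b) x))) /
          (b : ℝ) ^ Fintype.card ((Fin s × Fin α) × Fin n) -
      ∫ x in Set.univ.pi fun _ : Fin s => Set.Icc (0 : ℝ) 1, Fd 0 x| ≤
      c * (∑ a, β a) * (1 / (b : ℝ) ^ (n * α)) := by
  have hb : 0 < b := (Fact.out : b.Prime).pos
  have hcard : (b : ℝ) ^ Fintype.card ((Fin s × Fin α) × Fin n) =
      ((b ^ (n * α) : ℕ) : ℝ) ^ Fintype.card (Fin s) := by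
    simp only [Fintype.card_prod, Fintype.card_fin]
    push_cast
    ring
  rw [sum_fiberSum_scaledDigits, hcard]
  refine grid_average_error_le (pow_pos hb _) hcont fun x y hx hy hxy => ?_
  have hpartial : ∀ a x, (∀ i, x i ∈ Set.Icc (0 : ℝ) 1) →
      |Fd (0 + Pi.single a 1) x| ≤ c * β a := by
    intro a x hx
    rw [zero_add]
    have hle : ∀ i, (Pi.single a 1 : Fin s → ℕ) i ≤ 1 := fun i => by
      rcases eq_or_ne i a with rfl | h <;> simp [*]
    have h1 : ∏ i, (((Pi.single a 1 : Fin s → ℕ) i).factorial : ℝ) = 1 :=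
      Finset.prod_eq_one fun i _ => by rw [Nat.factorial_eq_one.2 (hle i), Nat.cast_one]
    have h2 : ∏ i, β i ^ (Pi.single a 1 : Fin s → ℕ) i = β a := by
      have h := prod_pow_sum_single β {a} id
      rwa [Finset.sum_singleton, Finset.prod_singleton] at h
    simpa [h1, h2] using hbd (Pi.single a 1) (fun i => (hle i).trans hα) x hx
  refine (abs_sub_le_of_partial_bound (f' := fun a => Fd (0 + Pi.single a 1))
    (fun a x => hd 0 a (fun _ => Nat.zero_le _) hα x) hpartial hx hy).trans ?_
  rw [Finset.mul_sum, Finset.sum_mul]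
  refine Finset.sum_le_sum fun a _ => mul_le_mul_of_nonneg_left ?_ (mul_nonneg hc (hβ a))
  exact_mod_cast hxy a

end WalshBound

/-- **Main result for product-form derivative bounds (Theorem 3.2).**
Let `0 < p ≤ 1`, let `(β_j)` be nonnegative with `∑ β_j^p < ∞`, let `b` be
prime and `α := ⌊1/p⌋ + 1`.  Then there is a constant `C` (depending only on
`α`, `β`, `b`, `p`) such that for all `s, m ≥ 1` with `N = b^m` there are QMC
points `y₀, …, y_{N-1} ∈ [0,1]^s` with the property: for every `c > 0` and
every `F : [0,1]^s → ℝ` with continuous mixed partial derivatives of order up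
to `α` in each variable (witnessed by the family `Fd ν = ∂^ν F`, where
consecutive partial derivatives are line derivatives along the coordinate
directions) satisfying the product-form bound
`|∂^ν F(y)| ≤ c·ν!·∏ β_j^{ν_j}` (with `ν! = ∏_j ν_j!`) on the cube for all
`ν ∈ {0,…,α}^s`, the QMC quadrature error satisfies
`|N⁻¹ ∑_n F(y_n) − ∫_{[0,1]^s} F| ≤ c·C·N^{-1/p}`.  No smallness condition
on `∑ β_j` is required when `p = 1`. -/
theorem higher_order_qmc_error_product (p : ℝ) (hp0 : 0 < p) (hp1 : p ≤ 1)
    (β : ℕ → ℝ) (hβ : ∀ j, 0 ≤ β j) (hβsum : Summable fun j => β j ^ p)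
    (b : ℕ) (hb : Nat.Prime b) :
    ∃ C : ℝ, 0 < C ∧
      ∀ s m : ℕ, 1 ≤ s → 1 ≤ m →
        ∃ y : Fin (b ^ m) → Fin s → ℝ,
          (∀ n i, y n i ∈ Set.Icc (0 : ℝ) 1) ∧
          ∀ (c : ℝ), 0 < c →
          ∀ (F : (Fin s → ℝ) → ℝ) (Fd : (Fin s → ℕ) → (Fin s → ℝ) → ℝ),
            Fd 0 = F →
            (∀ ν : Fin s → ℕ, (∀ i, ν i ≤ ⌊1 / p⌋₊ + 1) → Continuous (Fd ν)) →
            (∀ (ν : Fin s → ℕ) (j : Fin s), (∀ i, ν i ≤ ⌊1 / p⌋₊ + 1) →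
              ν j < ⌊1 / p⌋₊ + 1 → ∀ x : Fin s → ℝ,
                HasLineDerivAt ℝ (Fd ν) (Fd (ν + Pi.single j 1) x) x
                  (Pi.single j 1)) →
            (∀ ν : Fin s → ℕ, (∀ i, ν i ≤ ⌊1 / p⌋₊ + 1) →
              ∀ x : Fin s → ℝ, (∀ i, x i ∈ Set.Icc (0 : ℝ) 1) →
                |Fd ν x| ≤
                  c * (∏ i : Fin s, ((ν i).factorial : ℝ)) *
                    ∏ i : Fin s, β i.1 ^ ν i) →
            |(1 / (b ^ m : ℝ)) * ∑ n, F (y n) -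
                ∫ x in Set.univ.pi fun _ : Fin s => Set.Icc (0 : ℝ) 1, F x| ≤
              c * C * ((b : ℝ) ^ m) ^ (-(1 / p)) := by
  classical
  have : Fact b.Prime := ⟨hb⟩
  have hb1 : (1 : ℝ) < b := Nat.one_lt_cast.2 hb.one_lt
  have hb0 : (0 : ℝ) < b := zero_lt_one.trans hb1
  set α : ℕ := ⌊1 / p⌋₊ + 1 with hα
  have hα1 : 1 ≤ α := Nat.le_add_left _ _
  have hpα' : 1 / p < α := by
    rw [hα]
    exact_mod_cast Nat.lt_floor_add_one (1 / p)
  have hpα : 1 < p * α := by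
    rwa [div_lt_iff₀' hp0] at hpα'
  set B : ℝ := ∑' j, β j ^ p with hB
  have hβp : ∀ j, 0 ≤ β j ^ p := fun j => Real.rpow_nonneg (hβ j) p
  have hB0 : 0 ≤ B := tsum_nonneg hβp
  have hBs : ∀ s, ∑ a : Fin s, β a ^ p ≤ B := fun s => by
    rw [Fin.sum_univ_eq_sum_range (fun j => β j ^ p)]
    exact hβsum.sum_le_tsum _ fun j _ => hβp j
  set D : ℝ := (α : ℝ) ^ p * (b * (1 - (b : ℝ) ^ (1 - p * α))⁻¹) with hD
  have hD0 : 0 ≤ D := by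
    have h1 : (b : ℝ) ^ (1 - p * α) < 1 :=
      Real.rpow_lt_one_of_one_lt_of_neg hb1 (by linarith)
    have h2 : 0 < 1 - (b : ℝ) ^ (1 - p * α) := by linarith
    positivity
  refine ⟨Real.exp (D * (α * B)) ^ (1 / p) + B ^ (1 / p), by positivity, fun s m _ hm => ?_⟩
  have : NeZero m := ⟨by omega⟩
  have hW : ∀ k : (Fin s × Fin α) × Fin m → ZMod b,
      0 ≤ ∏ σ : Fin s × Fin α, leadWeight α (α * β σ.1) fun ℓ => k (σ, ℓ) := fun k =>
    Finset.prod_nonneg fun σ _ => leadWeight_nonneg α (mul_nonneg (Nat.cast_nonneg _) (hβ _)) _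
  obtain ⟨M, hM⟩ := exists_digital_net (J := Fin m) hp0 hp1 hW
  have e : Fin (b ^ m) ≃ (Fin m → ZMod b) := (Fintype.equivFinOfCardEq (by simp [ZMod.card])).symm
  let P : ((Fin s × Fin α) × Fin m → ZMod b) → Fin s → ℝ := fun x =>
    fiberSum (fun i => i.1.1) (scaledDigits (digitWeight s α m b) x)
  refine ⟨fun t => P (Matrix.mulVec M (e t)), fun t a => fiberSum_mem_Icc
    (scaledDigits_mem_Icc digitWeight_nonneg _) a, ?_⟩
  rintro c hc _ Fd rfl hcont hd hbd
  have hN : (0 : ℝ) < (b : ℝ) ^ m := pow_pos hb0 m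
  have hnet := hM c (fun x => Fd 0 (P x))
    (norm_walshCoeff_le_leadWeight (fun a => hβ a) hc.le hd hbd) hc.le
  have hgrid := digit_grid_error_le (b := b) (n := m) hα1 (hcont 0 fun _ => Nat.zero_le _)
    (fun a => hβ a) hc.le hd hbd
  have hS : ((∑ k : (Fin s × Fin α) × Fin m → ZMod b,
      (∏ σ : Fin s × Fin α, leadWeight α (α * β σ.1) fun ℓ => k (σ, ℓ)) ^ p) /
        (b : ℝ) ^ Fintype.card (Fin m)) ^ (1 / p) ≤
      Real.exp (D * (α * B)) ^ (1 / p) * ((b : ℝ) ^ m) ^ (-(1 / p)) := by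
    have hS0 := Finset.sum_nonneg fun k (_ : k ∈ Finset.univ) => Real.rpow_nonneg (hW k) p
    rw [Fintype.card_fin, Real.div_rpow hS0 hN.le, div_eq_mul_inv, ← Real.rpow_neg hN.le]
    refine mul_le_mul_of_nonneg_right (Real.rpow_le_rpow hS0 ?_ (by positivity)) (by positivity)
    refine (sum_prod_leadWeight_rpow_le hpα fun a => hβ a).trans (Real.exp_le_exp.2 ?_)
    exact mul_le_mul_of_nonneg_left
      (mul_le_mul_of_nonneg_left (hBs s) (Nat.cast_nonneg _)) hD0
  have hβs : ∑ a : Fin s, β a ≤ B ^ (1 / p) := by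
    have h0 : 0 ≤ ∑ a : Fin s, β a := Finset.sum_nonneg fun a _ => hβ a
    rw [one_div, Real.le_rpow_inv_iff_of_pos h0 hB0 hp0]
    exact (Real.rpow_sum_le_sum_rpow Finset.univ
      (f := fun a : Fin s => β a) (fun a _ => hβ a) hp0 hp1).trans (hBs s)
  have hpow : 1 / (b : ℝ) ^ (m * α) ≤ ((b : ℝ) ^ m) ^ (-(1 / p)) := by
    rw [Real.rpow_neg hN.le, ← one_div, pow_mul, ← Real.rpow_natCast _ α]
    refine one_div_le_one_div_of_le (by positivity) ?_
    exact Real.rpow_le_rpow_of_exponent_le (one_le_pow₀ hb1.le) hpα'.le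
  have hsum : (1 / (b : ℝ) ^ m) * ∑ t, Fd 0 (P (Matrix.mulVec M (e t))) =
      (∑ t, Fd 0 (P (Matrix.mulVec M t))) / (b : ℝ) ^ Fintype.card (Fin m) := by
    rw [one_div_mul_eq_div, Fintype.card_fin,
      Equiv.sum_comp e fun t => Fd 0 (P (Matrix.mulVec M t))]
  rw [hsum]
  calc _ ≤ _ := abs_sub_le _ _ _
    _ ≤ _ := add_le_add hnet hgrid
    _ ≤ c * (Real.exp (D * (α * B)) ^ (1 / p) * ((b : ℝ) ^ m) ^ (-(1 / p))) +
        c * B ^ (1 / p) * ((b : ℝ) ^ m) ^ (-(1 / p)) := by gcongr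
    _ = _ := by ring
end
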